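/- If K is a (2,k2,k3,k4)-cell in a smallest counterexample G, where 2 ≥ k2 ≥ k3 ≥ k4 ≥ 0, then k4 = 0. -/

import Mathlib

open SimpleGraph

/-- The degree of a vertex, as the cardinality of its neighbor set. -/
noncomputable def deg {V : Type} (G : SimpleGraph V) (v : V) : ℕ :=
  (G.neighborSet v).ncard

/-- The potential of a finite graph: `5 n(G) - 4 e(G)`. -/
noncomputable def pot {V : Type} [Fintype V] (G : SimpleGraph V) : ℤ :=
  5 * (Fintype.card V : ℤ) - 4 * (G.edgeSet.ncard : ℤ)

/-- A graph is 5/2-critical if it has no homomorphism to the 5-cycle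
but every proper subgraph has one. -/
def Critical52 {V : Type} (G : SimpleGraph V) : Prop :=
  IsEmpty (G →g cycleGraph 5) ∧
  ∀ H : G.Subgraph, H ≠ ⊤ → Nonempty (H.coe →g cycleGraph 5)

/-- The exceptional graph `E₁`: a 9-cycle `0 1 2 3 4 5 6 7 8` together
with a vertex `9` adjacent to `0`, `3` and `6`. -/
def E1 : SimpleGraph (Fin 10) := SimpleGraph.fromEdgeSet
  {s(0,1), s(1,2), s(2,3), s(3,4), s(4,5), s(5,6), s(6,7), s(7,8), s(8,0),
   s(9,0), s(9,3), s(9,6)}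

/-- The exceptional graph `E₂`: two 5-cycles `0 1 2 3 4` and `0 1 5 6 7`
sharing exactly the edge `01`, together with a path `3 8 9 6`. -/
def E2 : SimpleGraph (Fin 10) := SimpleGraph.fromEdgeSet
  {s(0,1), s(1,2), s(2,3), s(3,4), s(4,0),
   s(1,5), s(5,6), s(6,7), s(7,0),
   s(3,8), s(8,9), s(9,6)}

/-- A smallest counterexample: a 5/2-critical graph, not isomorphic to `C₃`, `E₁`, `E₂`,
with potential at least 2, such that every smaller 5/2-critical graph not isomorphic
to `C₃`, `E₁`, `E₂` has potential at most 1. -/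
def SmallestCex {V : Type} [Fintype V] (G : SimpleGraph V) : Prop :=
  Critical52 G ∧ IsEmpty (G ≃g cycleGraph 3) ∧ IsEmpty (G ≃g E1) ∧ IsEmpty (G ≃g E2) ∧
  2 ≤ pot G ∧
  ∀ (m : ℕ) (H : SimpleGraph (Fin m)), Critical52 H →
    IsEmpty (H ≃g cycleGraph 3) → IsEmpty (H ≃g E1) → IsEmpty (H ≃g E2) →
    m < Fintype.card V → pot H ≤ 1

/-- A string: a path of positive length whose endvertices have degree at least 3
and whose internal vertices have degree 2. A `k`-string is a string of length `k+1`. -/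
def IsString {V : Type} (G : SimpleGraph V) {u v : V} (p : G.Walk u v) : Prop :=
  p.IsPath ∧ 0 < p.length ∧ 3 ≤ deg G u ∧ 3 ≤ deg G v ∧
  ∀ w ∈ p.support, w ≠ u → w ≠ v → deg G w = 2

/-- `v` lies on a 5-cycle of `G`. -/
def InFiveCycle {V : Type} (G : SimpleGraph V) (v : V) : Prop :=
  ∃ (w : V) (c : G.Walk w w), c.IsCycle ∧ c.length = 5 ∧ v ∈ c.support

/-- `v` is a `(k₁,k₂,k₃)`-vertex: it has degree 3 and is the end of a `k₁`-string,
a `k₂`-string and a `k₃`-string leaving `v` through its three distinct edges. -/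
def IsVertex3 {V : Type} (G : SimpleGraph V) (v : V) (k1 k2 k3 : ℕ) : Prop :=
  deg G v = 3 ∧ ∃ (u1 u2 u3 : V) (p1 : G.Walk v u1) (p2 : G.Walk v u2) (p3 : G.Walk v u3),
    IsString G p1 ∧ IsString G p2 ∧ IsString G p3 ∧
    p1.getVert 1 ≠ p2.getVert 1 ∧ p1.getVert 1 ≠ p3.getVert 1 ∧ p2.getVert 1 ≠ p3.getVert 1 ∧
    p1.length = k1 + 1 ∧ p2.length = k2 + 1 ∧ p3.length = k3 + 1

/-- `v` is a `(k₁,k₂,k₃,k₄)`-vertex: it has degree 4 and is the end of strings of the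
corresponding lengths leaving `v` through its four distinct edges. -/
def IsVertex4 {V : Type} (G : SimpleGraph V) (v : V) (k1 k2 k3 k4 : ℕ) : Prop :=
  deg G v = 4 ∧ ∃ (u1 u2 u3 u4 : V) (p1 : G.Walk v u1) (p2 : G.Walk v u2)
    (p3 : G.Walk v u3) (p4 : G.Walk v u4),
    IsString G p1 ∧ IsString G p2 ∧ IsString G p3 ∧ IsString G p4 ∧
    p1.getVert 1 ≠ p2.getVert 1 ∧ p1.getVert 1 ≠ p3.getVert 1 ∧ p1.getVert 1 ≠ p4.getVert 1 ∧
    p2.getVert 1 ≠ p3.getVert 1 ∧ p2.getVert 1 ≠ p4.getVert 1 ∧ p3.getVert 1 ≠ p4.getVert 1 ∧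
    p1.length = k1 + 1 ∧ p2.length = k2 + 1 ∧ p3.length = k3 + 1 ∧ p4.length = k4 + 1

/-- `H` contains at least two distinct cycles, where cycles are counted as subgraphs,
i.e. two cycles are distinct if their edge sets differ. -/
def TwoDistinctCycles {V : Type} (H : SimpleGraph V) : Prop :=
  ∃ (v1 v2 : V) (c1 : H.Walk v1 v1) (c2 : H.Walk v2 v2),
    c1.IsCycle ∧ c2.IsCycle ∧ {e | e ∈ c1.edges} ≠ {e | e ∈ c2.edges}

/-- The degree of a 5-cycle (cell) `c` in `G`: the number of strings not contained in `c`
that intersect `c`, strings being counted by their edge sets. -/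
noncomputable def cellDegree {V : Type} (G : SimpleGraph V) {w : V} (c : G.Walk w w) : ℕ :=
  {S : Set (Sym2 V) | ∃ (u v : V) (p : G.Walk u v), IsString G p ∧ S = {e | e ∈ p.edges} ∧
    ¬ S ⊆ {e | e ∈ c.edges} ∧ ∃ x ∈ p.support, x ∈ c.support}.ncard

namespace CellProof

/-- adjacency in the 5-cycle -/
abbrev A5 (x y : Fin 5) : Prop := y = x + 1 ∨ x = y + 1

lemma A5.symm {x y : Fin 5} (h : A5 x y) : A5 y x := Or.symm h

lemma adj_c5 (x y : Fin 5) : (cycleGraph 5).Adj x y ↔ A5 x y := by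
  rw [SimpleGraph.cycleGraph_adj]
  revert x y; decide

/-- `H` has a homomorphism to the 5-cycle -/
def Col {U : Type} (H : SimpleGraph U) : Prop :=
  ∃ f : U → Fin 5, ∀ u v, H.Adj u v → A5 (f u) (f v)

lemma col_iff {U : Type} (H : SimpleGraph U) : Nonempty (H →g cycleGraph 5) ↔ Col H := by
  constructor
  · rintro ⟨f⟩
    exact ⟨f, fun u v h => (adj_c5 _ _).1 (f.map_adj h)⟩
  · rintro ⟨f, hf⟩
    exact ⟨⟨f, fun {u v} h => (adj_c5 _ _).2 (hf u v h)⟩⟩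

open Classical in
/-- number of ordered adjacent pairs in `A × B` -/
noncomputable def ee {U : Type} (H : SimpleGraph U) (A B : Finset U) : ℕ :=
  ((A ×ˢ B).filter (fun p => H.Adj p.1 p.2)).card

/-- potential of the subgraph induced by `A` -/
noncomputable def PP {U : Type} (H : SimpleGraph U) (A : Finset U) : ℤ :=
  5 * (A.card : ℤ) - 2 * (ee H A A : ℤ)

lemma pot_eq {U : Type} [Fintype U] (H : SimpleGraph U) : pot H = PP H Finset.univ := by
  classical
  unfold pot PP ee
  rw [Set.ncard_eq_toFinset_card']
  have h := SimpleGraph.two_mul_card_edgeFinset H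
  have e : H.edgeSet.toFinset.card = H.edgeFinset.card := by
    simp [SimpleGraph.edgeFinset]
  rw [e, Finset.card_univ]
  have : ((Finset.univ ×ˢ Finset.univ : Finset (U × U)).filter (fun p => H.Adj p.1 p.2)).card
      = 2 * H.edgeFinset.card := by
    rw [h]; congr 1
  rw [this]; push_cast; ring

/-- properties of a critical subgraph of a graph without colouring -/
structure CritIn {U : Type} (n : ℕ) (W : SimpleGraph U) (S : Finset U) : Prop where
  mem : ∀ u, u ∈ S ↔ ∃ v, W.Adj u v
  ncol : ¬ Col W
  deg2 : ∀ u v, W.Adj u v → ∃ v', v' ≠ v ∧ W.Adj u v'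
  small : S.card < n → PP W S ≤ 1 ∨
    (PP W S ≤ 3 ∧ S.card = 3 ∧ ∃ x y z, W.Adj x y ∧ W.Adj y z ∧ W.Adj z x) ∨
    (PP W S ≤ 2 ∧ ∀ u, ∀ N : Finset U, (∀ v ∈ N, W.Adj u v) → N.card ≤ 3)

lemma col_step : ∀ a : Fin 5, A5 (a + 1) a := by decide

instance : DecidableRel E1.Adj := fun a b => by
  unfold E1; rw [SimpleGraph.fromEdgeSet_adj]
  simp only [Set.mem_insert_iff, Set.mem_singleton_iff]; infer_instance
instance : DecidableRel E2.Adj := fun a b => by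
  unfold E2; rw [SimpleGraph.fromEdgeSet_adj]
  simp only [Set.mem_insert_iff, Set.mem_singleton_iff]; infer_instance

lemma pot_iso {U U' : Type} [Fintype U] [Fintype U'] {H : SimpleGraph U} {H' : SimpleGraph U'}
    (e : H ≃g H') : pot H = pot H' := by
  unfold pot
  rw [Fintype.card_congr e.toEquiv, ← Nat.card_coe_set_eq, ← Nat.card_coe_set_eq,
    Nat.card_congr e.mapEdgeSet]

lemma pot_eq_dec {U : Type} [Fintype U] (H : SimpleGraph U) [DecidableRel H.Adj] (n m : ℕ)
    (hn : Fintype.card U = n)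
    (hm : (Finset.filter (fun p : U × U => H.Adj p.1 p.2) Finset.univ).card = m) :
    pot H = 5 * (n : ℤ) - 2 * (m : ℤ) := by
  rw [pot_eq]; unfold PP ee
  rw [Finset.card_univ, hn, ← hm]
  congr!

lemma pot_C3 : pot (cycleGraph 3) = 3 :=
  (pot_eq_dec _ 3 6 (by simp) (by decide +kernel)).trans (by norm_num)
lemma pot_E1 : pot E1 = 2 :=
  (pot_eq_dec _ 10 24 (by simp) (by decide +kernel)).trans (by norm_num)
lemma pot_E2 : pot E2 = 2 :=
  (pot_eq_dec _ 10 24 (by simp) (by decide +kernel)).trans (by norm_num)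

lemma deg_E1 : ∀ a, (Finset.univ.filter (fun b => E1.Adj a b)).card ≤ 3 := by decide +kernel
lemma deg_E2 : ∀ a, (Finset.univ.filter (fun b => E2.Adj a b)).card ≤ 3 := by decide +kernel

lemma deg_of_iso {U U' : Type} [Fintype U] {H : SimpleGraph U} {H' : SimpleGraph U'}
    [DecidableRel H.Adj]
    (hd : ∀ a, (Finset.univ.filter (fun b => H.Adj a b)).card ≤ 3) (e : H' ≃g H)
    (u : U') (N : Finset U') (hN : ∀ v ∈ N, H'.Adj u v) : N.card ≤ 3 := by
  rw [← Finset.card_map e.toEquiv.toEmbedding]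
  refine le_trans (Finset.card_le_card ?_) (hd (e u))
  intro x hx
  simp only [Finset.mem_map] at hx
  obtain ⟨v, hv, rfl⟩ := hx
  simp only [Finset.mem_filter, Finset.mem_univ, true_and]
  exact e.map_adj_iff.2 (hN v hv)

lemma minimal_deg2 {U : Type} {W : SimpleGraph U} (hW : Minimal (fun X => ¬ Col X) W)
    (u v : U) (huv : W.Adj u v) : ∃ v', v' ≠ v ∧ W.Adj u v' := by
  classical
  by_contra hcon
  push Not at hcon
  have hlt : ¬ (¬ Col (W.deleteEdges {s(u, v)})) := by
    intro hc
    have := hW.2 hc (W.deleteEdges_le _) huv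
    simp [SimpleGraph.deleteEdges_adj] at this
  push Not at hlt
  obtain ⟨f, hf⟩ := hlt
  apply hW.1
  have huvne : u ≠ v := huv.ne
  refine ⟨Function.update f u (f v + 1), ?_⟩
  intro x y hxy
  by_cases hx : x = u
  · subst hx
    have hy : y = v := by by_contra h; exact hcon y h hxy
    subst hy
    rw [Function.update_self, Function.update_of_ne huvne.symm]
    exact col_step _
  · by_cases hy : y = u
    · subst hy
      have hx' : x = v := by by_contra h; exact hcon x h hxy.symm
      subst hx'
      rw [Function.update_self, Function.update_of_ne huvne.symm]
      exact (col_step _).symm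
    · rw [Function.update_of_ne hx, Function.update_of_ne hy]
      apply hf
      rw [SimpleGraph.deleteEdges_adj]
      refine ⟨hxy, ?_⟩
      simp only [Set.mem_singleton_iff, Sym2.eq_iff]
      tauto

theorem exists_crit {V : Type} [Fintype V] {G : SimpleGraph V} (h : SmallestCex G)
    {U : Type} [Fintype U] (H : SimpleGraph U) (hH : ¬ Col H) :
    ∃ W ≤ H, ∃ S : Finset U, CritIn (Fintype.card V) W S := by
  classical
  obtain ⟨W, hWH, hW⟩ := exists_minimal_le_of_wellFoundedLT (fun X : SimpleGraph U => ¬ Col X) H hH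
  refine ⟨W, hWH, Finset.univ.filter (fun u => ∃ v, W.Adj u v), ?_⟩
  set S := Finset.univ.filter (fun u => ∃ v, W.Adj u v) with hS
  have hmem : ∀ u, u ∈ S ↔ ∃ v, W.Adj u v := by intro u; simp [hS]
  refine ⟨hmem, hW.1, minimal_deg2 hW, ?_⟩
  intro hcard
  let e : Fin S.card ≃ S := S.equivFin.symm
  let H' : SimpleGraph (Fin S.card) := W.comap (fun i => (e i : U))
  have hadj : ∀ i j, H'.Adj i j ↔ W.Adj (e i) (e j) := fun i j => Iff.rfl
  have hinv : ∀ u, u ∈ S → ∃ i, (e i : U) = u := fun u hu => ⟨e.symm ⟨u, hu⟩, by simp⟩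
  have hinj : ∀ i j, (e i : U) = e j → i = j := fun i j hij => e.injective (Subtype.ext hij)
  have hmS : ∀ {u v}, W.Adj u v → u ∈ S := fun {u v} huv => (hmem u).2 ⟨v, huv⟩
  have hcrit : Critical52 H' := by
    constructor
    · rw [← not_nonempty_iff, col_iff]
      rintro ⟨f, hf⟩
      apply hW.1
      refine ⟨fun u => if hu : u ∈ S then f (e.symm ⟨u, hu⟩) else 0, ?_⟩
      intro u v huv
      have h1 := hmS huv
      have h2 := hmS huv.symm
      simp only [h1, h2, dif_pos]
      apply hf
      rw [hadj]; simpa using huv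
    · intro H0 hH0
      rw [col_iff]
      let W' : SimpleGraph U := SimpleGraph.mk
        (fun u v => ∃ i j, u = e i ∧ v = e j ∧ H0.Adj i j)
        ⟨by rintro u v ⟨i, j, hi, hj, hij⟩; exact ⟨j, i, hj, hi, hij.symm⟩⟩ ⟨by
          rintro u ⟨i, j, hi, hj, hij⟩
          have : i = j := hinj i j (hi.symm.trans hj)
          subst this
          exact hij.ne rfl⟩
      have hle : W' ≤ W := by
        rintro u v ⟨i, j, rfl, rfl, hij⟩
        exact (hadj i j).1 (H0.adj_sub hij)
      by_cases hc : Col W'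
      · obtain ⟨f, hf⟩ := hc
        exact ⟨fun i => f (e i), fun i j hij => hf _ _ ⟨i, j, rfl, rfl, hij⟩⟩
      · exfalso
        have hle' := hW.2 hc hle
        apply hH0
        have hA : ∀ i j, H'.Adj i j → H0.Adj i j := by
          intro i j hij
          obtain ⟨i', j', hi, hj, hij'⟩ := hle' ((hadj i j).1 hij)
          rw [hinj _ _ hi, hinj _ _ hj]; exact hij'
        ext i j
        · simp only [SimpleGraph.Subgraph.verts_top, Set.mem_univ, iff_true]
          obtain ⟨v, hv⟩ := (hmem _).1 (e i).2
          obtain ⟨j, rfl⟩ := hinv v (hmS hv.symm)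
          exact (hA i j hv).fst_mem
        · simp only [SimpleGraph.Subgraph.top_adj]
          exact ⟨fun x => H0.adj_sub x, hA i j⟩
  have hpot : pot H' = PP W S := by
    rw [pot_eq]
    unfold PP ee
    have h1 : (Finset.univ : Finset (Fin S.card)).card = S.card := by simp
    rw [h1]
    congr 3
    refine Finset.card_bij (fun p _ => ((e p.1 : U), (e p.2 : U))) ?_ ?_ ?_
    · intro p hp
      simp only [Finset.mem_filter, Finset.mem_product] at hp ⊢
      exact ⟨⟨(e p.1).2, (e p.2).2⟩, hp.2⟩
    · intro p _ q _ hpq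
      simp only [Prod.mk.injEq] at hpq
      exact Prod.ext (hinj _ _ hpq.1) (hinj _ _ hpq.2)
    · intro q hq
      simp only [Finset.mem_filter, Finset.mem_product] at hq
      obtain ⟨i, hi⟩ := hinv _ hq.1.1
      obtain ⟨j, hj⟩ := hinv _ hq.1.2
      refine ⟨(i, j), ?_, by simp [hi, hj]⟩
      simp only [Finset.mem_filter, Finset.mem_product, Finset.mem_univ, true_and]
      rw [hadj, hi, hj]; exact hq.2
  have hdeg : (∀ i, ∀ N : Finset (Fin S.card), (∀ v ∈ N, H'.Adj i v) → N.card ≤ 3) →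
      ∀ u, ∀ N : Finset U, (∀ v ∈ N, W.Adj u v) → N.card ≤ 3 := by
    intro hd u N hN
    by_cases hne : N.Nonempty
    · obtain ⟨v, hv⟩ := hne
      obtain ⟨i, rfl⟩ := hinv u (hmS (hN v hv))
      have := hd i (Finset.univ.filter (fun j => (e j : U) ∈ N)) (by
        intro j hj; simp only [Finset.mem_filter] at hj; exact hN _ hj.2)
      refine le_trans (le_of_eq ?_) this
      symm
      refine Finset.card_bij (fun j _ => (e j : U)) ?_ ?_ ?_
      · intro j hj; simp only [Finset.mem_filter] at hj; exact hj.2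
      · intro i _ j _ hij; exact hinj _ _ hij
      · intro b hb
        obtain ⟨j, rfl⟩ := hinv b (hmS (hN b hb).symm)
        exact ⟨j, by simpa using hb, rfl⟩
    · rw [Finset.not_nonempty_iff_eq_empty.1 hne]; simp
  obtain ⟨_, _, _, _, _, hmin⟩ := h
  by_cases c3 : IsEmpty (H' ≃g cycleGraph 3)
  · by_cases c1 : IsEmpty (H' ≃g E1)
    · by_cases c2 : IsEmpty (H' ≃g E2)
      · left; rw [← hpot]; exact hmin _ H' hcrit c3 c1 c2 hcard
      · obtain ⟨e2⟩ := not_isEmpty_iff.1 c2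
        right; right
        refine ⟨by rw [← hpot, pot_iso e2, pot_E2], hdeg (deg_of_iso deg_E2 e2)⟩
    · obtain ⟨e2⟩ := not_isEmpty_iff.1 c1
      right; right
      refine ⟨by rw [← hpot, pot_iso e2, pot_E1], hdeg (deg_of_iso deg_E1 e2)⟩
  · obtain ⟨e2⟩ := not_isEmpty_iff.1 c3
    right; left
    refine ⟨by rw [← hpot, pot_iso e2, pot_C3], ?_, ?_⟩
    · have := Fintype.card_congr e2.toEquiv
      simpa using this
    · have key : ∀ i j, (cycleGraph 3).Adj i j → W.Adj (e (e2.symm i)) (e (e2.symm j)) := by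
        intro i j hij
        exact (hadj _ _).1 (e2.symm.map_adj_iff.2 hij)
      exact ⟨_, _, _, key 0 1 (by decide), key 1 2 (by decide), key 2 0 (by decide)⟩

end CellProof

namespace CellProof
set_option linter.unusedSectionVars false
set_option linter.unusedSimpArgs false

open Classical in
/-- number of related pairs in `A × B` -/
noncomputable def rc {α β : Type} (R : α → β → Prop) (A : Finset α) (B : Finset β) : ℕ :=
  ((A ×ˢ B).filter (fun p => R p.1 p.2)).card

lemma ee_eq {U : Type} (H : SimpleGraph U) (A B : Finset U) : ee H A B = rc H.Adj A B := rfl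

lemma rc_union_left {α β : Type} [DecidableEq α] (R : α → β → Prop) (A A' : Finset α) (B : Finset β)
    (h : Disjoint A A') : rc R (A ∪ A') B = rc R A B + rc R A' B := by
  classical
  unfold rc
  rw [Finset.union_product, Finset.filter_union, Finset.card_union_of_disjoint]
  apply Finset.disjoint_filter_filter
  rw [Finset.disjoint_product]; exact Or.inl h

lemma rc_union_right {α β : Type} [DecidableEq β] (R : α → β → Prop) (A : Finset α) (B B' : Finset β)
    (h : Disjoint B B') : rc R A (B ∪ B') = rc R A B + rc R A B' := by
  classical
  unfold rc
  rw [Finset.product_union, Finset.filter_union, Finset.card_union_of_disjoint]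
  apply Finset.disjoint_filter_filter
  rw [Finset.disjoint_product]; exact Or.inr h

lemma rc_le {α β α' β' : Type} {R : α → β → Prop} {R' : α' → β' → Prop} {A : Finset α}
    {B : Finset β} {A' : Finset α'} {B' : Finset β'} (i : α → β → α' × β')
    (hi : ∀ a ∈ A, ∀ b ∈ B, R a b → (i a b).1 ∈ A' ∧ (i a b).2 ∈ B' ∧ R' (i a b).1 (i a b).2)
    (hinj : ∀ a ∈ A, ∀ b ∈ B, R a b → ∀ a' ∈ A, ∀ b' ∈ B, R a' b' → i a b = i a' b' →
      a = a' ∧ b = b') : rc R A B ≤ rc R' A' B' := by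
  classical
  unfold rc
  refine Finset.card_le_card_of_injOn (fun p => i p.1 p.2) ?_ ?_
  · intro p hp
    simp only [Finset.coe_filter, Finset.mem_product, Set.mem_ofPred_eq] at hp ⊢
    have := hi p.1 hp.1.1 p.2 hp.1.2 hp.2
    exact ⟨⟨this.1, this.2.1⟩, this.2.2⟩
  · intro p hp q hq hpq
    simp only [Finset.coe_filter, Finset.mem_product, Set.mem_ofPred_eq] at hp hq
    have := hinj p.1 hp.1.1 p.2 hp.1.2 hp.2 q.1 hq.1.1 q.2 hq.1.2 hq.2 hpq
    exact Prod.ext this.1 this.2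

lemma rc_mono {α β : Type} {R R' : α → β → Prop} {A : Finset α} {B : Finset β}
    (h : ∀ a ∈ A, ∀ b ∈ B, R a b → R' a b) : rc R A B ≤ rc R' A B :=
  rc_le (fun a b => (a, b)) (fun a ha b hb hab => ⟨ha, hb, h a ha b hb hab⟩)
    (fun a _ b _ _ a' _ b' _ _ hh => by simpa using hh)

lemma ee_comm {U : Type} (H : SimpleGraph U) (A B : Finset U) : ee H A B = ee H B A := by
  have key : ∀ A B : Finset U, ee H A B ≤ ee H B A := fun A B =>
    rc_le (fun a b => (b, a)) (fun a ha b hb hab => ⟨hb, ha, hab.symm⟩)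
      (fun a _ b _ _ a' _ b' _ _ hh => by
        simp only [Prod.mk.injEq] at hh; exact ⟨hh.2, hh.1⟩)
  exact le_antisymm (key A B) (key B A)

lemma PP_union {U : Type} [DecidableEq U] (H : SimpleGraph U) (A B : Finset U) (h : Disjoint A B) :
    PP H (A ∪ B) = PP H A + PP H B - 4 * (ee H A B : ℤ) := by
  unfold PP
  have h1 : ee H (A ∪ B) (A ∪ B) = ee H A A + ee H B A + (ee H A B + ee H B B) := by
    simp only [ee_eq]
    rw [rc_union_right _ _ _ _ h, rc_union_left _ _ _ _ h, rc_union_left _ _ _ _ h]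
  rw [h1, ee_comm H B A, Finset.card_union_of_disjoint h]
  push_cast; ring

lemma PP_singleton {U : Type} (H : SimpleGraph U) (x : U) : PP H {x} = 5 := by
  have : ee H {x} {x} = 0 := by
    unfold ee
    rw [Finset.card_eq_zero]
    ext p
    simp only [Finset.mem_filter, Finset.mem_product, Finset.mem_singleton,
      Finset.notMem_empty, iff_false]
    rintro ⟨⟨h1, h2⟩, h⟩
    rw [h1, h2] at h; exact H.loopless.irrefl _ h
  unfold PP
  rw [this]; simp

lemma PP_insert {U : Type} [DecidableEq U] (H : SimpleGraph U) (Y N : Finset U) (x : U) (hx : x ∉ Y)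
    (hN : N ⊆ Y) (hadj : ∀ y ∈ N, H.Adj x y) :
    PP H (insert x Y) ≤ PP H Y + 5 - 4 * (N.card : ℤ) := by
  rw [Finset.insert_eq, PP_union _ _ _ (by simpa using hx), PP_singleton]
  have : N.card ≤ ee H {x} Y := by
    classical
    unfold ee
    refine Finset.card_le_card_of_injOn (fun y => (x, y)) ?_ ?_
    · intro y hy
      simp only [Finset.coe_filter, Finset.mem_product, Set.mem_ofPred_eq, Finset.mem_singleton,
        true_and]
      exact ⟨hN hy, hadj y hy⟩
    · intro y _ y' _ hyy; simpa using hyy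
  have : (N.card : ℤ) ≤ ee H {x} Y := by exact_mod_cast this
  linarith

lemma rc_map {α β α' β' : Type} (R : α' → β' → Prop) (A : Finset α) (B : Finset β)
    (i : α ↪ α') (j : β ↪ β') :
    rc R (A.map i) (B.map j) = rc (fun a b => R (i a) (j b)) A B := by
  classical
  unfold rc
  symm
  refine Finset.card_bij (fun p _ => (i p.1, j p.2)) ?_ ?_ ?_
  · intro p hp
    simp only [Finset.mem_filter, Finset.mem_product, Finset.mem_map] at hp ⊢
    exact ⟨⟨⟨_, hp.1.1, rfl⟩, ⟨_, hp.1.2, rfl⟩⟩, hp.2⟩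
  · intro p _ q _ h
    simp only [Prod.mk.injEq, EmbeddingLike.apply_eq_iff_eq] at h
    exact Prod.ext h.1 h.2
  · intro q hq
    simp only [Finset.mem_filter, Finset.mem_product, Finset.mem_map] at hq
    obtain ⟨⟨⟨a, ha, h1⟩, ⟨b, hb, h2⟩⟩, h3⟩ := hq
    refine ⟨(a, b), ?_, Prod.ext h1 h2⟩
    simp only [Finset.mem_filter, Finset.mem_product]
    exact ⟨⟨ha, hb⟩, by rw [h1, h2]; exact h3⟩

lemma PP_disjSum {α β : Type} (W : SimpleGraph (α ⊕ β)) (Z : Finset α) (T : Finset β) :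
    PP W (Z.disjSum T) = 5 * (Z.card : ℤ) + 5 * (T.card : ℤ)
      - 2 * (rc (fun a b => W.Adj (Sum.inl a) (Sum.inl b)) Z Z : ℤ)
      - 4 * (rc (fun a b => W.Adj (Sum.inl a) (Sum.inr b)) Z T : ℤ)
      - 2 * (rc (fun a b => W.Adj (Sum.inr a) (Sum.inr b)) T T : ℤ) := by
  classical
  have h : Z.disjSum T = Z.map Function.Embedding.inl ∪ T.map Function.Embedding.inr := by
    ext x; simp [Finset.mem_disjSum]
  have hd : Disjoint (Z.map (Function.Embedding.inl : α ↪ α ⊕ β))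
      (T.map Function.Embedding.inr) := by
    rw [Finset.disjoint_left]; intro x hx; simp at hx ⊢
    obtain ⟨a, ha, rfl⟩ := hx; simp
  rw [h, PP_union _ _ _ hd]
  unfold PP
  simp only [ee_eq, rc_map, Finset.card_map, Function.Embedding.inl_apply,
    Function.Embedding.inr_apply]
  ring

section
variable {V : Type} [Fintype V] {G : SimpleGraph V}

lemma crit_ncol (h : Critical52 G) : ¬ Col G := by
  rw [← col_iff, not_nonempty_iff]; exact h.1

lemma sub_col (h : Critical52 G) (Y : Finset V) (x : V) (hx : x ∉ Y) :
    ∃ f : V → Fin 5, ∀ u ∈ Y, ∀ v ∈ Y, G.Adj u v → A5 (f u) (f v) := by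
  classical
  have := h.2 ((⊤ : G.Subgraph).induce (Y : Set V)) (by
    intro hh
    have : x ∈ ((⊤ : G.Subgraph).induce (Y : Set V)).verts := by rw [hh]; simp
    simp at this; exact hx this)
  rw [col_iff] at this
  obtain ⟨f, hf⟩ := this
  refine ⟨fun v => if hv : v ∈ Y then f ⟨v, by simpa using hv⟩ else 0, ?_⟩
  intro u hu v hv huv
  simp only [hu, hv, dif_pos]
  apply hf
  simp only [SimpleGraph.Subgraph.coe_adj, SimpleGraph.Subgraph.induce_adj,
    SimpleGraph.Subgraph.top_adj]
  exact ⟨hu, hv, huv⟩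

lemma c5_pot : ∀ S : Finset (Fin 5), S.Nonempty →
    5 ≤ 5 * (S.card : ℤ) - 2 * (rc A5 S S : ℤ) := by
  intro S hS
  have : ∀ S : Finset (Fin 5), S.Nonempty →
      5 ≤ 5 * (S.card : ℤ) - 2 * (((S ×ˢ S).filter (fun p => A5 p.1 p.2)).card : ℤ) := by
    decide +kernel
  convert this S hS
  unfold rc; congr!

theorem pot_lemma (h : SmallestCex G) : ∀ n, ∀ Y : Finset V, Y.Nonempty →
    Fintype.card V = Y.card + n → 0 < n → 4 ≤ PP G Y ∧ (3 ≤ n → 5 ≤ PP G Y) := by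
  classical
  intro n
  induction n using Nat.strong_induction_on with
  | _ n ih =>
  intro Y hY hn hn0
  obtain ⟨x, hx⟩ : ∃ x, x ∉ Y := by
    by_contra hcon
    push Not at hcon
    have : Y = Finset.univ := by ext; simp [hcon]
    rw [this, Finset.card_univ] at hn; omega
  obtain ⟨f, hf⟩ := sub_col h.1 Y x hx
  by_cases hinj : Set.InjOn f (Y : Set V)
  · have h1 : rc G.Adj Y Y ≤ rc A5 (Y.image f) (Y.image f) := by
      refine rc_le (fun a b => (f a, f b)) ?_ ?_
      · intro a ha b hb hab
        exact ⟨Finset.mem_image_of_mem _ ha, Finset.mem_image_of_mem _ hb, hf a ha b hb hab⟩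
      · intro a ha b hb _ a' ha' b' hb' _ hh
        simp only [Prod.mk.injEq] at hh
        exact ⟨hinj ha ha' hh.1, hinj hb hb' hh.2⟩
    have h2 := c5_pot (Y.image f) (hY.image f)
    rw [Finset.card_image_of_injOn hinj] at h2
    have h3 : 5 ≤ PP G Y := by
      unfold PP; rw [ee_eq]
      have : (rc G.Adj Y Y : ℤ) ≤ rc A5 (Y.image f) (Y.image f) := by exact_mod_cast h1
      linarith
    exact ⟨by linarith, fun _ => h3⟩
  · -- quotient graph
    let φ : V → V ⊕ Fin 5 := fun v => if v ∈ Y then Sum.inr (f v) else Sum.inl v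
    have φY : ∀ v, v ∈ Y → φ v = Sum.inr (f v) := fun v hv => by simp [φ, hv]
    have φN : ∀ v, v ∉ Y → φ v = Sum.inl v := fun v hv => by simp [φ, hv]
    have φl : ∀ u v, φ u = Sum.inl v → u = v ∧ v ∉ Y := by
      intro u v huv
      by_cases hu : u ∈ Y
      · rw [φY u hu] at huv; cases huv
      · rw [φN u hu] at huv; cases huv; exact ⟨rfl, hu⟩
    have φr : ∀ u s, φ u = Sum.inr s → u ∈ Y ∧ f u = s := by
      intro u v huv
      by_cases hu : u ∈ Y
      · rw [φY u hu] at huv; cases huv; exact ⟨hu, rfl⟩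
      · rw [φN u hu] at huv; cases huv
    let H : SimpleGraph (V ⊕ Fin 5) := SimpleGraph.mk
      (fun p q => ∃ u v, G.Adj u v ∧ φ u = p ∧ φ v = q)
      ⟨by rintro p q ⟨u, v, huv, hu, hv⟩; exact ⟨v, u, huv.symm, hv, hu⟩⟩
      ⟨by
        rintro p ⟨u, v, huv, hu, hv⟩
        rcases p with p | s
        · obtain ⟨rfl, _⟩ := φl _ _ hu
          obtain ⟨rfl, _⟩ := φl _ _ hv
          exact huv.ne rfl
        · obtain ⟨hu, hs⟩ := φr _ _ hu
          obtain ⟨hv, hs'⟩ := φr _ _ hv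
          have := hf u hu v hv huv
          rw [hs, hs'] at this
          exact absurd this ((by decide : ∀ s : Fin 5, ¬ A5 s s) s)⟩
    have hH : ¬ Col H := by
      rintro ⟨g, hg⟩
      exact crit_ncol h.1 ⟨fun v => g (φ v), fun u v huv => hg _ _ ⟨u, v, huv, rfl, rfl⟩⟩
    obtain ⟨W, hWH, S, hS⟩ := exists_crit h H hH
    let Z : Finset V := Finset.univ.filter (fun v => Sum.inl v ∈ S)
    let T : Finset (Fin 5) := Finset.univ.filter (fun v => Sum.inr v ∈ S)
    have hZT : S = Z.disjSum T := by
      ext x; rcases x with x | x <;> simp [Z, T]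
    have hZY : ∀ z ∈ Z, z ∉ Y := by
      intro z hz
      simp only [Z, Finset.mem_filter, Finset.mem_univ, true_and] at hz
      obtain ⟨q, hq⟩ := (hS.mem _).1 hz
      obtain ⟨u, v, huv, hu, hv⟩ := hWH hq
      exact (φl _ _ hu).2
    have hTY : T ⊆ Y.image f := by
      intro s hs
      simp only [T, Finset.mem_filter, Finset.mem_univ, true_and] at hs
      obtain ⟨q, hq⟩ := (hS.mem _).1 hs
      obtain ⟨u, v, huv, hu, hv⟩ := hWH hq
      obtain ⟨h1, h2⟩ := φr _ _ hu
      exact Finset.mem_image.2 ⟨u, h1, h2⟩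
    have hdisj : Disjoint Y Z := by
      rw [Finset.disjoint_right]; exact hZY
    have hTne : T.Nonempty := by
      by_contra hT
      obtain ⟨y, hy⟩ := hY
      obtain ⟨g, hg⟩ := sub_col h.1 Yᶜ y (by simpa using hy)
      apply hS.ncol
      refine ⟨Sum.elim g (fun _ => 0), ?_⟩
      intro p q hpq
      have hp := (hS.mem p).2 ⟨q, hpq⟩
      have hq := (hS.mem q).2 ⟨p, hpq.symm⟩
      have hno : ∀ s, Sum.inr s ∉ S := by
        intro s hs
        exact hT ⟨s, by simpa [T] using hs⟩
      rcases p with p | p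
      · rcases q with q | q
        · obtain ⟨u, v, huv, hu, hv⟩ := hWH hpq
          obtain ⟨rfl, hu⟩ := φl _ _ hu
          obtain ⟨rfl, hv⟩ := φl _ _ hv
          exact hg u (by simpa using hu) v (by simpa using hv) huv
        · exact absurd hq (hno _)
      · exact absurd hp (hno _)
    have hZne : Z.Nonempty := by
      by_contra hT
      apply hS.ncol
      refine ⟨Sum.elim (fun _ => 0) id, ?_⟩
      intro p q hpq
      have hp := (hS.mem p).2 ⟨q, hpq⟩
      have hq := (hS.mem q).2 ⟨p, hpq.symm⟩
      have hno : ∀ s, Sum.inl s ∉ S := by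
        intro s hs
        exact hT ⟨s, by simpa [Z] using hs⟩
      rcases p with p | p
      · exact absurd hp (hno _)
      · rcases q with q | q
        · exact absurd hq (hno _)
        · obtain ⟨u, v, huv, hu, hv⟩ := hWH hpq
          obtain ⟨hu', rfl⟩ := φr _ _ hu
          obtain ⟨hv', rfl⟩ := φr _ _ hv
          exact hf u hu' v hv' huv
    have hPW := PP_disjSum W Z T
    rw [← hZT] at hPW
    have h1 : rc (fun a b => W.Adj (Sum.inl a) (Sum.inl b)) Z Z ≤ ee G Z Z := by
      refine rc_mono ?_
      intro a _ b _ hab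
      obtain ⟨u, v, huv, hu, hv⟩ := hWH hab
      obtain ⟨rfl, hu⟩ := φl _ _ hu
      obtain ⟨rfl, hv⟩ := φl _ _ hv
      exact huv
    have h2 : rc (fun a b => W.Adj (Sum.inl a) (Sum.inr b)) Z T ≤ ee G Y Z := by
      rw [ee_comm]
      have key : ∀ a s, W.Adj (Sum.inl a) (Sum.inr s) → ∃ y, y ∈ Y ∧ f y = s ∧ G.Adj a y := by
        intro a s has
        obtain ⟨u, v, huv, hu, hv⟩ := hWH has
        obtain ⟨rfl, hu⟩ := φl _ _ hu
        obtain ⟨hv', rfl⟩ := φr _ _ hv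
        exact ⟨v, hv', rfl, huv⟩
      refine rc_le (fun a s => if has : W.Adj (Sum.inl a) (Sum.inr s) then
        (a, (key a s has).choose) else (a, a)) ?_ ?_
      · intro a ha s hs has
        have := (key a s has).choose_spec
        simp only [has, dif_pos]
        exact ⟨ha, this.1, this.2.2⟩
      · intro a ha s hs has a' ha' s' hs' has' heq
        simp only [has, has', dif_pos, Prod.mk.injEq] at heq
        refine ⟨heq.1, ?_⟩
        rw [← (key a s has).choose_spec.2.1, heq.2, (key a' s' has').choose_spec.2.1]
    have h3 : rc (fun a b => W.Adj (Sum.inr a) (Sum.inr b)) T T ≤ rc A5 T T := by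
      refine rc_mono ?_
      intro a _ b _ hab
      obtain ⟨u, v, huv, hu, hv⟩ := hWH hab
      obtain ⟨hu', rfl⟩ := φr _ _ hu
      obtain ⟨hv', rfl⟩ := φr _ _ hv
      exact hf u hu' v hv' huv
    have h4 := c5_pot T hTne
    have h5 := PP_union G Y Z hdisj
    have h6 : PP G Z = 5 * (Z.card : ℤ) - 2 * (ee G Z Z : ℤ) := rfl
    have hmain : PP G (Y ∪ Z) ≤ PP G Y + PP W S - 5 := by
      zify at h1 h2 h3
      linarith
    have hTlt : T.card < Y.card := by
      refine lt_of_le_of_lt (Finset.card_le_card hTY) ?_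
      refine lt_of_le_of_ne Finset.card_image_le ?_
      intro hh
      exact hinj (Finset.card_image_iff.1 hh)
    have hcU : (Y ∪ Z).card = Y.card + Z.card := Finset.card_union_of_disjoint hdisj
    have hle : (Y ∪ Z).card ≤ Fintype.card V := Finset.card_le_univ _
    have hScard : S.card = Z.card + T.card := by rw [hZT, Finset.card_disjSum]
    have hZpos := hZne.card_pos
    have hTpos := hTne.card_pos
    have htri := hS.small (by omega)
    have hV : 2 ≤ PP G Finset.univ := by rw [← pot_eq]; exact h.2.2.2.2.1
    by_cases hfull : Y ∪ Z = Finset.univ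
    · rw [hfull] at hmain
      rw [hfull, Finset.card_univ] at hcU
      rcases htri with h' | ⟨h', h'', _⟩ | ⟨h', _⟩
      · exact ⟨by linarith, fun _ => by linarith⟩
      · exact ⟨by linarith, fun _ => by omega⟩
      · exact ⟨by linarith, fun _ => by linarith⟩
    · have hlt : (Y ∪ Z).card < Fintype.card V := by
        rw [Finset.card_lt_iff_ne_univ]; exact hfull
      have := (ih (n - Z.card) (by omega) (Y ∪ Z) (hY.mono Finset.subset_union_left)
        (by omega) (by omega)).1
      have : PP W S ≤ 3 := by
        rcases htri with h' | ⟨h', h'', _⟩ | ⟨h', _⟩ <;> linarith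
      exact ⟨by linarith, fun _ => by linarith⟩

lemma P4 (h : SmallestCex G) (Y : Finset V) (hY : Y.Nonempty) (x : V) (hx : x ∉ Y) :
    4 ≤ PP G Y := by
  have h1 : Y.card < Fintype.card V := by
    rw [Finset.card_lt_iff_ne_univ]; rintro rfl; simp at hx
  exact (pot_lemma h (Fintype.card V - Y.card) Y hY (by omega) (by omega)).1

open Classical in
lemma P5 (h : SmallestCex G) (Y : Finset V) (hY : Y.Nonempty) (A : Finset V)
    (hd : Disjoint Y A) (hA : 3 ≤ A.card) : 5 ≤ PP G Y := by
  have h1 := Finset.card_union_of_disjoint hd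
  have h2 : (Y ∪ A).card ≤ Fintype.card V := Finset.card_le_univ _
  exact (pot_lemma h (Fintype.card V - Y.card) Y hY (by omega) (by omega)).2 (by omega)

lemma P2 (h : SmallestCex G) (Y : Finset V) (hY : Y.Nonempty) : 2 ≤ PP G Y := by
  by_cases hf : Y = Finset.univ
  · rw [hf, ← pot_eq]; exact h.2.2.2.2.1
  · obtain ⟨x, hx⟩ : ∃ x, x ∉ Y := by
      by_contra hcon; push Not at hcon; exact hf (by ext; simp [hcon])
    linarith [P4 h Y hY x hx]
end
end CellProof

namespace CellProof
set_option linter.unusedSectionVars false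
set_option linter.unusedSimpArgs false

/-- A 5-cycle with four strings of one or two internal vertices leaving it. -/
structure Cell {V : Type} (G : SimpleGraph V) where
  v : Fin 5 → V
  k : Fin 4 → ℕ
  j : Fin 4 → Fin 5
  y : Fin 4 → Fin 2 → V
  b : Fin 4 → V
  vinj : Function.Injective v
  vadj : ∀ i, G.Adj (v i) (v (i + 1))
  hk : ∀ i, k i = 1 ∨ k i = 2
  y1 : ∀ i, k i = 1 → y i 1 = y i 0
  y2 : ∀ i, k i = 2 → y i 0 ≠ y i 1 ∧ G.Adj (y i 0) (y i 1)
  yv : ∀ i l t, y i l ≠ v t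
  yy : ∀ i l i' l', y i l = y i' l' → i = i'
  bv : ∀ i t, b i ≠ v t
  bny : ∀ i i' l, b i ≠ y i' l
  a_y : ∀ i, G.Adj (v (j i)) (y i 0)
  y_b : ∀ i, G.Adj (y i 1) (b i)
  vE : ∀ t u, G.Adj (v t) u → (∃ t', u = v t' ∧ A5 t t') ∨ ∃ i, t = j i ∧ u = y i 0
  yE0 : ∀ i u, G.Adj (y i 0) u → u = v (j i) ∨ (k i = 2 ∧ u = y i 1) ∨ (k i = 1 ∧ u = b i)
  yE1 : ∀ i u, k i = 2 → G.Adj (y i 1) u → u = y i 0 ∨ u = b i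

/-- walks of length `k+1` in the 5-cycle -/
def R : ℕ → Fin 5 → Fin 5 → Bool
  | 0, x, y => y == x + 1 || x == y + 1
  | 1, x, y => x == y || (y == x + 2 || x == y + 2)
  | 2, x, y => x != y
  | _, _, _ => true

lemma R0 {x y : Fin 5} : R 0 x y = true ↔ A5 x y := by revert x y; decide
lemma R1 : ∀ x y : Fin 5, R 1 x y = true → ∃ w, A5 x w ∧ A5 w y := by decide
lemma R2 : ∀ x y : Fin 5, R 2 x y = true → ∃ w w', A5 x w ∧ A5 w w' ∧ A5 w' y := by decide
lemma R1' : ∀ x w y : Fin 5, A5 x w → A5 w y → R 1 x y = true := by decide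
lemma R2' : ∀ x w w' y : Fin 5, A5 x w → A5 w w' → A5 w' y → R 2 x y = true := by decide

namespace Cell
variable {V : Type} {G : SimpleGraph V} (C : Cell G)

def InD (u : V) : Prop := (∃ t, u = C.v t) ∨ ∃ i l, u = C.y i l

lemma extend (c : Fin 5 → Fin 5) (hc : ∀ t t', A5 t t' → A5 (c t) (c t'))
    (g : V → Fin 5) (hg : ∀ u u', ¬ C.InD u → ¬ C.InD u' → G.Adj u u' → A5 (g u) (g u'))
    (hR : ∀ i, R (C.k i) (c (C.j i)) (g (C.b i)) = true) : Col G := by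
  classical
  have hw : ∀ i, ∃ w : Fin 2 → Fin 5, A5 (c (C.j i)) (w 0) ∧ (C.k i = 2 → A5 (w 0) (w 1)) ∧
      (C.k i = 1 → w 1 = w 0) ∧ A5 (w 1) (g (C.b i)) := by
    intro i
    rcases C.hk i with hi | hi
    · have := hR i; rw [hi] at this
      obtain ⟨w, h1, h2⟩ := R1 _ _ this
      exact ⟨fun _ => w, h1, fun h => by omega, fun _ => rfl, h2⟩
    · have := hR i; rw [hi] at this
      obtain ⟨w, w', h1, h2, h3⟩ := R2 _ _ this
      exact ⟨![w, w'], h1, fun _ => h2, fun h => by omega, h3⟩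
  choose w hw0 hw1 hw2 hw3 using hw
  let h : V → Fin 5 := fun u => if hu : ∃ t, u = C.v t then c hu.choose else
    if hu' : ∃ i l, u = C.y i l then w hu'.choose hu'.choose_spec.choose else g u
  have hv : ∀ t, h (C.v t) = c t := by
    intro t
    have hu : ∃ t', C.v t = C.v t' := ⟨t, rfl⟩
    have h1 : h (C.v t) = c hu.choose := by simp only [h]; rw [dif_pos hu]
    rw [h1]
    congr 1
    exact (C.vinj hu.choose_spec).symm
  have hy : ∀ i l, h (C.y i l) = w i l := by
    intro i l
    have hu : ¬ ∃ t', C.y i l = C.v t' := by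
      rintro ⟨t, ht⟩; exact C.yv _ _ _ ht
    have hu' : ∃ i' l', C.y i l = C.y i' l' := ⟨i, l, rfl⟩
    have h1 : h (C.y i l) = w hu'.choose hu'.choose_spec.choose := by
      simp only [h]; rw [dif_neg hu, dif_pos hu']
    rw [h1]
    have h2 := hu'.choose_spec.choose_spec
    have h3 : i = hu'.choose := C.yy _ _ _ _ h2
    generalize hu'.choose_spec.choose = l' at h2 ⊢
    generalize hu'.choose = i' at h2 h3 ⊢
    subst h3
    rcases C.hk i with hi | hi
    · have e1 := hw2 i hi
      have : ∀ l, w i l = w i 0 := by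
        intro l; fin_cases l
        · rfl
        · exact e1
      rw [this l, this l']
    · have := (C.y2 i hi).1
      fin_cases l <;> fin_cases l'
      · rfl
      · exact absurd h2 this
      · exact absurd h2.symm this
      · rfl
  have ho : ∀ u, ¬ C.InD u → h u = g u := by
    intro u hu
    unfold InD at hu
    push Not at hu
    simp only [h]
    rw [dif_neg (by push Not; exact hu.1), dif_neg (by push Not; exact hu.2)]
  have hb : ∀ i, h (C.b i) = g (C.b i) := by
    intro i; apply ho
    rintro (⟨t, ht⟩ | ⟨i', l, ht⟩)
    · exact C.bv _ _ ht
    · exact C.bny _ _ _ ht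
  have key : ∀ u u', C.InD u → G.Adj u u' → A5 (h u) (h u') := by
    intro u u' hu huu
    have aux1 : ∀ i, A5 (h (C.y i 0)) (h (C.v (C.j i))) := by
      intro i; rw [hv, hy]; exact (hw0 i).symm
    rcases hu with ⟨t, rfl⟩ | ⟨i, l, rfl⟩
    · rcases C.vE t u' huu with ⟨t', rfl, htt⟩ | ⟨i, rfl, rfl⟩
      · rw [hv, hv]; exact hc _ _ htt
      · exact (aux1 i).symm
    · have hl : C.y i l = C.y i 0 ∨ (C.k i = 2 ∧ C.y i l = C.y i 1) := by
        fin_cases l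
        · exact Or.inl rfl
        · rcases C.hk i with hi | hi
          · exact Or.inl (C.y1 i hi)
          · exact Or.inr ⟨hi, rfl⟩
      rcases hl with hl | ⟨hi, hl⟩
      · rw [hl] at huu ⊢
        rcases C.yE0 i u' huu with rfl | ⟨hi, rfl⟩ | ⟨hi, rfl⟩
        · exact aux1 i
        · rw [hy, hy]; exact hw1 i hi
        · rw [hy, hb, ← hw2 i hi]; exact hw3 i
      · rw [hl] at huu ⊢
        rcases C.yE1 i u' hi huu with rfl | rfl
        · rw [hy, hy]; exact (hw1 i hi).symm
        · rw [hy, hb]; exact hw3 i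
  refine ⟨h, ?_⟩
  intro u u' huu
  by_cases hu : C.InD u
  · exact key u u' hu huu
  · by_cases hu' : C.InD u'
    · exact (key u' u hu' huu.symm).symm
    · rw [ho u hu, ho u' hu']; exact hg u u' hu hu' huu

section LB
variable [DecidableEq V]

/-- vertices of the 5-cycle -/
def K : Finset V := Finset.univ.image C.v
/-- internal vertices of the string `i` -/
def I (i : Fin 4) : Finset V := {C.y i 0, C.y i 1}

lemma mem_K {u : V} : u ∈ C.K ↔ ∃ t, u = C.v t := by
  simp [K, eq_comm]
lemma mem_I {u : V} {i : Fin 4} : u ∈ C.I i ↔ ∃ l, u = C.y i l := by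
  simp [I, Fin.exists_fin_two]
lemma card_K : C.K.card = 5 := by
  unfold K; rw [Finset.card_image_of_injective _ C.vinj]; simp
lemma card_I (i : Fin 4) : (C.I i).card = C.k i := by
  unfold I
  rcases C.hk i with hi | hi
  · rw [C.y1 i hi, hi]; simp
  · rw [hi, Finset.card_pair (C.y2 i hi).1]
lemma disj_I {i i' : Fin 4} (h : i ≠ i') : Disjoint (C.I i) (C.I i') := by
  rw [Finset.disjoint_left]; intro x hx hx'
  rw [mem_I] at hx hx'
  obtain ⟨l, rfl⟩ := hx
  obtain ⟨l', hl⟩ := hx'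
  exact h (C.yy _ _ _ _ hl)
lemma disj_KI (i : Fin 4) : Disjoint C.K (C.I i) := by
  rw [Finset.disjoint_left]; intro x hx hx'
  rw [mem_I] at hx'; rw [mem_K] at hx
  obtain ⟨l, rfl⟩ := hx
  obtain ⟨l', hl⟩ := hx'
  exact C.yv _ _ _ hl.symm

/-- all vertices of the cell and its strings -/
def D : Finset V := C.K ∪ Finset.univ.biUnion C.I
lemma mem_D {u : V} : u ∈ C.D ↔ C.InD u := by
  simp only [D, Finset.mem_union, mem_K, Finset.mem_biUnion, mem_I, InD, Finset.mem_univ, true_and]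

lemma card_D : C.D.card = 5 + ∑ i, C.k i := by
  unfold D
  rw [Finset.card_union_of_disjoint, card_K, Finset.card_biUnion]
  · simp only [card_I]
  · intro i _ i' _ h; exact C.disj_I h
  · rw [Finset.disjoint_biUnion_right]; intro i _; exact C.disj_KI i

lemma PP_K (X : Finset V) (hX : ∀ x ∈ X, ¬ C.InD x) : PP G (X ∪ C.K) ≤ PP G X + 5 := by
  have nX : ∀ t, C.v t ∉ X := fun t ht => hX _ ht (Or.inl ⟨t, rfl⟩)
  have ne : ∀ s t, s ≠ t → C.v s ≠ C.v t := fun s t h h' => h (C.vinj h')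
  have e : X ∪ C.K = insert (C.v 4) (insert (C.v 3) (insert (C.v 2) (insert (C.v 1)
      (insert (C.v 0) X)))) := by
    ext u
    simp only [Finset.mem_union, mem_K, Finset.mem_insert, Fin.exists_fin_succ]
    simp
    tauto
  rw [e]
  have h0 := PP_insert G X ∅ (C.v 0) (nX 0) (by simp) (by simp)
  have h1 := PP_insert G (insert (C.v 0) X) {C.v 0} (C.v 1)
    (by simp [nX, ne]) (by simp) (by simpa using (C.vadj 0).symm)
  have h2 := PP_insert G (insert (C.v 1) (insert (C.v 0) X)) {C.v 1} (C.v 2)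
    (by simp [nX, ne]) (by simp) (by simpa using (C.vadj 1).symm)
  have h3 := PP_insert G (insert (C.v 2) (insert (C.v 1) (insert (C.v 0) X))) {C.v 2} (C.v 3)
    (by simp [nX, ne]) (by simp) (by simpa using (C.vadj 2).symm)
  have h4 := PP_insert G (insert (C.v 3) (insert (C.v 2) (insert (C.v 1) (insert (C.v 0) X))))
    {C.v 3, C.v 0} (C.v 4)
    (by simp [nX, ne]) (by intro x; simp; tauto) (by
      intro x hx
      simp only [Finset.mem_insert, Finset.mem_singleton] at hx
      rcases hx with rfl | rfl
      · exact (C.vadj 3).symm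
      · exact C.vadj 4)
  rw [Finset.card_pair (ne _ _ (by decide))] at h4
  simp only [Finset.card_singleton, Finset.card_empty] at h0 h1 h2 h3
  push_cast at *
  linarith

lemma PP_I (Y : Finset V) (i : Fin 4) (hv : C.v (C.j i) ∈ Y) (hb : C.b i ∈ Y)
    (hy : ∀ l, C.y i l ∉ Y) : PP G (Y ∪ C.I i) ≤ PP G Y + ((C.k i : ℤ) - 4) := by
  have hne : C.v (C.j i) ≠ C.b i := (C.bv _ _).symm
  rcases C.hk i with hi | hi
  · have e : Y ∪ C.I i = insert (C.y i 0) Y := by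
      ext u; simp [I, C.y1 i hi]
    rw [e, hi]
    have := PP_insert G Y {C.v (C.j i), C.b i} (C.y i 0) (hy 0) (by
      intro x; simp; rintro (rfl | rfl) <;> assumption) (by
      intro x hx; simp at hx; rcases hx with rfl | rfl
      · exact (C.a_y i).symm
      · have := C.y_b i; rwa [C.y1 i hi] at this)
    rw [Finset.card_pair hne] at this
    push_cast at *; linarith
  · have e : Y ∪ C.I i = insert (C.y i 1) (insert (C.y i 0) Y) := by
      ext u; simp [I]; tauto
    rw [e, hi]
    have h0 := PP_insert G Y {C.v (C.j i)} (C.y i 0) (hy 0) (by simpa using hv) (by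
      intro x hx; simp at hx; subst hx; exact (C.a_y i).symm)
    have h1 := PP_insert G (insert (C.y i 0) Y) {C.y i 0, C.b i} (C.y i 1)
      (by simp only [Finset.mem_insert, not_or]; exact ⟨(C.y2 i hi).1.symm, hy 1⟩) (by
      intro x; simp; rintro (rfl | rfl)
      · simp
      · exact Or.inr hb) (by
      intro x hx; simp at hx; rcases hx with rfl | rfl
      · exact (C.y2 i hi).2.symm
      · exact C.y_b i)
    rw [Finset.card_pair (C.bny _ _ _).symm] at h1
    rw [Finset.card_singleton] at h0
    push_cast at *; linarith

lemma PP_add (X : Finset V) (hX : ∀ x ∈ X, ¬ C.InD x) (U : Finset (Fin 4))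
    (hb : ∀ i ∈ U, C.b i ∈ X) :
    PP G (X ∪ C.K ∪ U.biUnion C.I) ≤ PP G X + 5 + ∑ i ∈ U, ((C.k i : ℤ) - 4) := by
  induction U using Finset.induction_on with
  | empty => simpa using C.PP_K X hX
  | insert i U hi ih =>
    have ih' := ih (fun i' hi' => hb i' (Finset.mem_insert_of_mem hi'))
    rw [Finset.sum_insert hi]
    have e : X ∪ C.K ∪ (insert i U).biUnion C.I = (X ∪ C.K ∪ U.biUnion C.I) ∪ C.I i := by
      rw [Finset.biUnion_insert]; ext u; simp only [Finset.mem_union]; tauto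
    rw [e]
    have := C.PP_I (X ∪ C.K ∪ U.biUnion C.I) i
      (by simp only [Finset.mem_union, mem_K]; exact Or.inl (Or.inr ⟨_, rfl⟩))
      (by simp only [Finset.mem_union]; exact Or.inl (Or.inl (hb i (Finset.mem_insert_self _ _))))
      (by
        intro l hl
        simp only [Finset.mem_union, mem_K, Finset.mem_biUnion, mem_I] at hl
        rcases hl with (hl | ⟨t, ht⟩) | ⟨i', hi', l', hl⟩
        · exact hX _ hl (Or.inr ⟨i, l, rfl⟩)
        · exact C.yv _ _ _ ht
        · have := C.yy _ _ _ _ hl; subst this; exact hi hi')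
    linarith

end LB
end Cell

/-- lower bound for the potential of a set containing the far ends of the strings in `U` -/
def LBf (k : Fin 4 → ℕ) (U : Finset (Fin 4)) : ℤ :=
  if U.card = 2 ∧ ∑ i ∈ U, k i = 2 then 6 else
  if U.card = 3 then 11 - ((∑ i ∈ U, k i : ℕ) : ℤ) else
  if U.card = 4 then 13 - ((∑ i ∈ U, k i : ℕ) : ℤ) else 5

theorem Cell.LB {V : Type} [Fintype V] {G : SimpleGraph V} (h : SmallestCex G) (C : Cell G)
    (hk0 : C.k 0 = 2) (X : Finset V) (hX : ∀ x ∈ X, ¬ C.InD x) (hne : X.Nonempty)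
    (U : Finset (Fin 4)) (hb : ∀ i ∈ U, C.b i ∈ X) : LBf C.k U ≤ PP G X := by
  classical
  have hadd := C.PP_add X hX U hb
  have hne' : (X ∪ C.K ∪ U.biUnion C.I).Nonempty :=
    hne.mono (by intro x hx; simp [hx])
  have hnot : ∀ i l, i ∉ U → C.y i l ∉ X ∪ C.K ∪ U.biUnion C.I := by
    intro i l hi hl
    simp only [Finset.mem_union, C.mem_K, Finset.mem_biUnion, C.mem_I] at hl
    rcases hl with (hl | ⟨t, ht⟩) | ⟨i', hi', l', hl⟩
    · exact hX _ hl (Or.inr ⟨i, l, rfl⟩)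
    · exact C.yv _ _ _ ht
    · have := C.yy _ _ _ _ hl; subst this; exact hi hi'
  have hsum : ∑ i ∈ U, ((C.k i : ℤ) - 4) = ((∑ i ∈ U, C.k i : ℕ) : ℤ) - 4 * (U.card : ℤ) := by
    rw [Finset.sum_sub_distrib]; push_cast; simp; ring
  rw [hsum] at hadd
  unfold LBf
  split_ifs with h1 h2 h3
  · obtain ⟨hc, hs⟩ := h1
    have hk1 : ∀ i, 1 ≤ C.k i := fun i => by rcases C.hk i with h | h <;> omega
    have h0 : (0 : Fin 4) ∉ U := by
      intro h0
      rw [← Finset.add_sum_erase _ _ h0, hk0] at hs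
      have h3 : ∑ i ∈ U.erase 0, 1 ≤ ∑ i ∈ U.erase 0, C.k i := Finset.sum_le_sum fun i _ => hk1 i
      simp only [Finset.sum_const, Finset.card_erase_of_mem h0, hc] at h3
      simp at h3; omega
    obtain ⟨i, hi0, hiU⟩ : ∃ i : Fin 4, i ≠ 0 ∧ i ∉ U := by
      by_contra hcon
      push Not at hcon
      have : ({1, 2, 3} : Finset (Fin 4)) ⊆ U := by
        intro i hi; apply hcon; rintro rfl; revert hi; decide
      have := Finset.card_le_card this
      rw [hc] at this; revert this; decide
    have hA := P5 h (X ∪ C.K ∪ U.biUnion C.I) hne' (C.I 0 ∪ C.I i) (by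
      rw [Finset.disjoint_right]
      intro x hx
      simp only [Finset.mem_union, C.mem_I] at hx
      rcases hx with ⟨l, rfl⟩ | ⟨l, rfl⟩
      · exact hnot _ _ h0
      · exact hnot _ _ hiU) (by
      rw [Finset.card_union_of_disjoint (C.disj_I hi0.symm), C.card_I, C.card_I, hk0]
      have := hk1 i; omega)
    rw [hs, hc] at hadd; push_cast at hadd; linarith
  · obtain ⟨i, hiU⟩ : ∃ i : Fin 4, i ∉ U := by
      by_contra hcon
      push Not at hcon
      have : U = Finset.univ := by ext; simp [hcon]
      rw [this] at h2; simp at h2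
    have := P4 h _ hne' (C.y i 0) (hnot _ _ hiU)
    rw [h2] at hadd; push_cast at *; linarith
  · have := P2 h _ hne'
    rw [h3] at hadd; push_cast at *; linarith
  · refine P5 h X hne C.K ?_ (by rw [C.card_K]; omega)
    rw [Finset.disjoint_left]
    intro x hx hx'
    exact hX x hx (Or.inl (C.mem_K.1 hx'))

end CellProof

namespace CellProof
set_option linter.unusedSectionVars false
set_option linter.unusedSimpArgs false

/-- vertices of the gadget: two star centres and internal vertices of their legs -/
abbrev GT := Fin 2 × Option (Fin 4 × Fin 2)

/-- internal adjacency of the gadget (oriented away from the centre) -/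
def gInt (kk : Fin 2 → Fin 4 → ℕ) : GT → GT → Prop
  | (c, none), (c', some (i, l)) => c = c' ∧ l = 0 ∧ (kk c i = 1 ∨ kk c i = 2)
  | (c, some (i, l)), (c', some (i', l')) => c = c' ∧ i = i' ∧ l = 0 ∧ l' = 1 ∧ kk c i = 2
  | _, _ => False

/-- attachment of the gadget -/
def gCon {V : Type} (b : Fin 4 → V) (kk : Fin 2 → Fin 4 → ℕ) (u : V) : GT → Prop
  | (c, none) => ∃ i, kk c i = 0 ∧ u = b i
  | (c, some (i, l)) => kk c i = l.val + 1 ∧ u = b i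

def gLev : GT → ℕ
  | (_, none) => 0
  | (_, some (_, l)) => l.val + 1

lemma gInt_lev (kk : Fin 2 → Fin 4 → ℕ) (t t' : GT) (h : gInt kk t t') :
    gLev t' = gLev t + 1 := by
  obtain ⟨c, _ | ⟨i, l⟩⟩ := t <;> obtain ⟨c', _ | ⟨i', l'⟩⟩ := t' <;> simp [gInt, gLev] at *
  · simp [h.2.1]
  · obtain ⟨_, _, h1, h2, _⟩ := h; simp [h1, h2]

/-- the set `J` of legs used at each star costs this much -/
def gCost (kk : Fin 2 → Fin 4 → ℕ) (J : Fin 2 → Finset (Fin 4)) : ℤ :=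
  ∑ c, if (J c).Nonempty then -5 + ∑ i ∈ J c, (4 - (kk c i : ℤ)) else 0

/-- end vertex of a leg -/
def gEnd (kk : Fin 2 → Fin 4 → ℕ) (c : Fin 2) (i : Fin 4) : GT :=
  if kk c i = 0 then (c, none) else if kk c i = 1 then (c, some (i, 0)) else (c, some (i, 1))

lemma gCon_end {V : Type} {b : Fin 4 → V} {kk : Fin 2 → Fin 4 → ℕ} {u : V} {t : GT}
    (h : gCon b kk u t) : ∃ c i, kk c i ≤ 2 ∧ u = b i ∧ t = gEnd kk c i := by
  obtain ⟨c, _ | ⟨i, l⟩⟩ := t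
  · obtain ⟨i, h1, h2⟩ := h
    exact ⟨c, i, by omega, h2, by simp [gEnd, h1]⟩
  · obtain ⟨h1, h2⟩ := h
    refine ⟨c, i, ?_, h2, ?_⟩
    · have := l.2; omega
    · fin_cases l
      · simp at h1; simp [gEnd, h1]
      · simp at h1; simp [gEnd, h1]

lemma gInt_pair {kk : Fin 2 → Fin 4 → ℕ} {t t' : GT} (h : gInt kk t t') :
    ∃ (c : Fin 2) (i : Fin 4) (l : Fin 2), l.val < kk c i ∧ kk c i ≤ 2 ∧
      t = (if l = 0 then (c, none) else (c, some (i, 0))) ∧ t' = (c, some (i, l)) := by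
  obtain ⟨c, _ | ⟨i, l⟩⟩ := t <;> obtain ⟨c', _ | ⟨i', l'⟩⟩ := t' <;> simp only [gInt] at h
  · obtain ⟨rfl, rfl, h⟩ := h
    exact ⟨c, i', 0, by simp; omega, by omega, by simp, rfl⟩
  · obtain ⟨rfl, rfl, rfl, rfl, h⟩ := h
    exact ⟨c, i, 1, by simp; omega, by omega, by simp, rfl⟩

section
variable {V : Type} {G : SimpleGraph V} (C : Cell G) (kk : Fin 2 → Fin 4 → ℕ)

def gAdj : V ⊕ GT → V ⊕ GT → Prop
  | Sum.inl u, Sum.inl v => ¬ C.InD u ∧ ¬ C.InD v ∧ G.Adj u v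
  | Sum.inl u, Sum.inr t => gCon C.b kk u t
  | Sum.inr t, Sum.inl u => gCon C.b kk u t
  | Sum.inr t, Sum.inr t' => gInt kk t t' ∨ gInt kk t' t

/-- the gadget graph -/
def gH : SimpleGraph (V ⊕ GT) := SimpleGraph.mk (gAdj C kk)
  ⟨by
    rintro (u | t) (v | t') h
    · exact ⟨h.2.1, h.1, h.2.2.symm⟩
    · exact h
    · exact h
    · exact Or.symm h⟩
  ⟨by
    rintro (u | t) h
    · exact h.2.2.ne rfl
    · rcases h with h | h <;> have := gInt_lev _ _ _ h <;> omega⟩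

lemma gH_notri (hΔ : ∀ x y z, G.Adj x y → G.Adj y z → G.Adj z x → False)
    (h0 : ∀ c i j, i ≠ j → kk c i = 0 → kk c j = 0 → C.b i ≠ C.b j ∧ ¬ G.Adj (C.b i) (C.b j))
    (h1 : ∀ c i j, kk c i = 0 → kk c j = 1 → C.b i ≠ C.b j) :
    ∀ p q r, (gH C kk).Adj p q → (gH C kk).Adj q r → (gH C kk).Adj r p → False := by
  have two : ∀ u v t, G.Adj u v → gCon C.b kk u t → gCon C.b kk v t → False := by
    rintro u v ⟨c, _ | ⟨i, l⟩⟩ huv hu hv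
    · obtain ⟨i, hi, rfl⟩ := hu
      obtain ⟨j, hj, rfl⟩ := hv
      by_cases hij : i = j
      · subst hij; exact huv.ne rfl
      · exact (h0 c i j hij hi hj).2 huv
    · obtain ⟨_, rfl⟩ := hu
      obtain ⟨_, rfl⟩ := hv
      exact huv.ne rfl
  have one' : ∀ u t t', gInt kk t t' → gCon C.b kk u t → gCon C.b kk u t' → False := by
    rintro u ⟨c, _ | ⟨i, l⟩⟩ ⟨c', _ | ⟨i', l'⟩⟩ h hu hv
    · simp [gInt] at h
    · simp only [gInt] at h
      obtain ⟨rfl, rfl, h⟩ := h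
      obtain ⟨i, hi, rfl⟩ := hu
      obtain ⟨hj, he⟩ := hv
      exact h1 c i i' hi (by simpa using hj) he
    · simp [gInt] at h
    · simp only [gInt] at h
      obtain ⟨rfl, rfl, rfl, rfl, h⟩ := h
      obtain ⟨hi, rfl⟩ := hu
      obtain ⟨hj, he⟩ := hv
      simp at hi hj; omega
  have one : ∀ u t t', (gInt kk t t' ∨ gInt kk t' t) → gCon C.b kk u t → gCon C.b kk u t' →
      False := by
    intro u t t' h hu hv
    rcases h with h | h
    · exact one' u t t' h hu hv
    · exact one' u t' t h hv hu
  rintro (u | t) (u' | t') (u'' | t'') hp hq hr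
  · exact hΔ u u' u'' hp.2.2 hq.2.2 hr.2.2
  · exact two u u' t'' hp.2.2 hr hq
  · exact two u'' u t' hr.2.2 hq hp
  · exact one u t' t'' hq hp hr
  · exact two u' u'' t hq.2.2 hp hr
  · exact one u' t'' t hr hq hp
  · exact one u'' t t' hp hr hq
  · rcases hp with hp | hp <;> rcases hq with hq | hq <;> rcases hr with hr | hr <;>
    have e1 := gInt_lev _ _ _ hp <;> have e2 := gInt_lev _ _ _ hq <;>
    have e3 := gInt_lev _ _ _ hr <;> omega

end

theorem gadget {V : Type} [Fintype V] {G : SimpleGraph V} (h : SmallestCex G) (C : Cell G)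
    (hk0 : C.k 0 = 2) (hΔ : ∀ x y z, G.Adj x y → G.Adj y z → G.Adj z x → False)
    (kk : Fin 2 → Fin 4 → ℕ)
    (h0 : ∀ c i j, i ≠ j → kk c i = 0 → kk c j = 0 → C.b i ≠ C.b j ∧ ¬ G.Adj (C.b i) (C.b j))
    (h1 : ∀ c i j, kk c i = 0 → kk c j = 1 → C.b i ≠ C.b j)
    (hsize : ∑ c, (1 + ∑ i, if kk c i ≤ 2 then kk c i else 0) ≤ 9)
    (hadm : ∀ J : Fin 2 → Finset (Fin 4), (∀ c, ∀ i ∈ J c, kk c i ≤ 2) →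
      (∀ c, (J c).Nonempty → 2 ≤ (J c).card) → (J 0 ∪ J 1).Nonempty →
      gCost kk J + 1 < LBf C.k (J 0 ∪ J 1) ∧
      ((∀ c, (J c).card ≤ 3) → gCost kk J + 2 < LBf C.k (J 0 ∪ J 1))) :
    ∃ g : V → Fin 5, (∀ u u', ¬ C.InD u → ¬ C.InD u' → G.Adj u u' → A5 (g u) (g u')) ∧
      ∀ c, ∃ z, ∀ i, R (kk c i) z (g (C.b i)) = true := by
  classical
  by_cases hcol : Col (gH C kk)
  · obtain ⟨f, hf⟩ := hcol
    refine ⟨fun u => f (Sum.inl u), fun u u' hu hu' huu => hf _ _ ⟨hu, hu', huu⟩, ?_⟩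
    intro c
    refine ⟨f (Sum.inr (c, none)), ?_⟩
    intro i
    rcases hki : kk c i with _ | _ | _ | n
    · rw [R0]
      exact hf (Sum.inr (c, none)) (Sum.inl (C.b i)) ⟨i, hki, rfl⟩
    · refine R1' _ (f (Sum.inr (c, some (i, 0)))) _ (hf _ _ ?_) (hf _ _ ?_)
      · exact Or.inl ⟨rfl, rfl, Or.inl (by omega)⟩
      · exact ⟨by simpa using hki, rfl⟩
    · refine R2' _ (f (Sum.inr (c, some (i, 0)))) (f (Sum.inr (c, some (i, 1)))) _
        (hf _ _ ?_) (hf _ _ ?_) (hf _ _ ?_)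
      · exact Or.inl ⟨rfl, rfl, Or.inr (by omega)⟩
      · exact Or.inl ⟨rfl, rfl, rfl, rfl, by omega⟩
      · exact ⟨by simpa using hki, rfl⟩
    · rfl
  exfalso
  obtain ⟨W, hWH, S, hS⟩ := exists_crit h (gH C kk) hcol
  have bD : ∀ i, ¬ C.InD (C.b i) := by
    rintro i (⟨t, ht⟩ | ⟨i', l, ht⟩)
    · exact C.bv _ _ ht
    · exact C.bny _ _ _ ht
  -- used legs
  let J : Fin 2 → Finset (Fin 4) := fun c => Finset.univ.filter (fun i => kk c i ≤ 2 ∧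
    W.Adj (Sum.inl (C.b i)) (Sum.inr (gEnd kk c i)))
  have memJ : ∀ c i, i ∈ J c ↔ kk c i ≤ 2 ∧ W.Adj (Sum.inl (C.b i)) (Sum.inr (gEnd kk c i)) := by
    intro c i; simp [J]
  -- neighbours
  have nbZ : ∀ c q, W.Adj (Sum.inr (c, none)) q → ∃ i, (kk c i = 0 ∧ q = Sum.inl (C.b i)) ∨
      ((kk c i = 1 ∨ kk c i = 2) ∧ q = Sum.inr (c, some (i, 0))) := by
    intro c q hq
    have := hWH hq
    rcases q with u | ⟨c', _ | ⟨i, l⟩⟩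
    · obtain ⟨i, hi, rfl⟩ := this
      exact ⟨i, Or.inl ⟨hi, rfl⟩⟩
    · rcases this with h | h <;> exact h.elim
    · rcases this with h | h
      · obtain ⟨rfl, rfl, h⟩ := h
        exact ⟨i, Or.inr ⟨h, rfl⟩⟩
      · exact h.elim
  have nbY0 : ∀ c i q, W.Adj (Sum.inr (c, some (i, 0))) q →
      ((kk c i = 1 ∨ kk c i = 2) ∧ q = Sum.inr (c, none)) ∨ (kk c i = 1 ∧ q = Sum.inl (C.b i)) ∨
      (kk c i = 2 ∧ q = Sum.inr (c, some (i, 1))) := by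
    intro c i q hq
    have := hWH hq
    rcases q with u | ⟨c', _ | ⟨i', l⟩⟩
    · obtain ⟨hi, rfl⟩ := this
      exact Or.inr (Or.inl ⟨by simpa using hi, rfl⟩)
    · rcases this with h | h
      · exact h.elim
      · obtain ⟨rfl, _, h⟩ := h
        exact Or.inl ⟨h, rfl⟩
    · rcases this with h | h
      · obtain ⟨rfl, rfl, _, rfl, h⟩ := h
        exact Or.inr (Or.inr ⟨h, rfl⟩)
      · obtain ⟨_, _, _, h, _⟩ := h
        exact absurd h (by decide)
  have nbY1 : ∀ c i q, W.Adj (Sum.inr (c, some (i, 1))) q →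
      (kk c i = 2 ∧ q = Sum.inr (c, some (i, 0))) ∨ (kk c i = 2 ∧ q = Sum.inl (C.b i)) := by
    intro c i q hq
    have := hWH hq
    rcases q with u | ⟨c', _ | ⟨i', l⟩⟩
    · obtain ⟨hi, rfl⟩ := this
      exact Or.inr ⟨by simpa using hi, rfl⟩
    · rcases this with h | h
      · exact h.elim
      · obtain ⟨_, h, _⟩ := h
        exact absurd h (by decide)
    · rcases this with h | h
      · obtain ⟨_, _, h, _⟩ := h
        exact absurd h (by decide)
      · obtain ⟨rfl, rfl, rfl, _, h⟩ := h
        exact Or.inl ⟨h, rfl⟩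
  -- each leg is used entirely or not at all
  have y1J : ∀ c i, (∃ q, W.Adj (Sum.inr (c, some (i, 1))) q) → kk c i = 2 ∧ i ∈ J c ∧
      W.Adj (Sum.inr (c, some (i, 1))) (Sum.inr (c, some (i, 0))) := by
    rintro c i ⟨q, hq⟩
    obtain ⟨q', hne, hq'⟩ := hS.deg2 _ _ hq
    have key : kk c i = 2 → W.Adj (Sum.inr (c, some (i, 1))) (Sum.inl (C.b i)) → i ∈ J c := by
      intro h2 hw
      rw [memJ]; refine ⟨by omega, ?_⟩
      simp only [gEnd, h2]; simpa using hw.symm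
    rcases nbY1 c i q hq with ⟨h2, rfl⟩ | ⟨h2, rfl⟩
    · rcases nbY1 c i q' hq' with ⟨_, rfl⟩ | ⟨_, rfl⟩
      · exact absurd rfl hne
      · exact ⟨h2, key h2 hq', hq⟩
    · rcases nbY1 c i q' hq' with ⟨_, rfl⟩ | ⟨_, rfl⟩
      · exact ⟨h2, key h2 hq, hq'⟩
      · exact absurd rfl hne
  have y0J : ∀ c i, (∃ q, W.Adj (Sum.inr (c, some (i, 0))) q) → (kk c i = 1 ∨ kk c i = 2) ∧
      i ∈ J c ∧ W.Adj (Sum.inr (c, some (i, 0))) (Sum.inr (c, none)) ∧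
      (kk c i = 2 → W.Adj (Sum.inr (c, some (i, 0))) (Sum.inr (c, some (i, 1)))) := by
    rintro c i ⟨q, hq⟩
    obtain ⟨q', hne, hq'⟩ := hS.deg2 _ _ hq
    have key : ∀ q q', q' ≠ q → W.Adj (Sum.inr (c, some (i, 0))) q →
        W.Adj (Sum.inr (c, some (i, 0))) q' → q = Sum.inr (c, none) →
        (kk c i = 1 ∨ kk c i = 2) ∧
        i ∈ J c ∧ W.Adj (Sum.inr (c, some (i, 0))) (Sum.inr (c, none)) ∧
        (kk c i = 2 → W.Adj (Sum.inr (c, some (i, 0))) (Sum.inr (c, some (i, 1)))) := by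
      intro q q' hne hq hq' e
      subst e
      rcases nbY0 c i q' hq' with ⟨h2, rfl⟩ | ⟨h2, rfl⟩ | ⟨h2, rfl⟩
      · exact absurd rfl hne
      · refine ⟨Or.inl h2, ?_, hq, fun h3 => by omega⟩
        rw [memJ]; refine ⟨by omega, ?_⟩
        simp only [gEnd, h2]; simpa using hq'.symm
      · exact ⟨Or.inr h2, (y1J c i ⟨_, hq'.symm⟩).2.1, hq, fun _ => hq'⟩
    rcases nbY0 c i q hq with ⟨h2, e⟩ | ⟨h2, e⟩ | ⟨h2, e⟩
    · exact key q q' hne hq hq' e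
    · rcases nbY0 c i q' hq' with ⟨h2', e'⟩ | ⟨h2', e'⟩ | ⟨h2', e'⟩
      · exact key q' q hne.symm hq' hq e'
      · exact absurd (e'.trans e.symm) hne
      · omega
    · rcases nbY0 c i q' hq' with ⟨h2', e'⟩ | ⟨h2', e'⟩ | ⟨h2', e'⟩
      · exact key q' q hne.symm hq' hq e'
      · omega
      · exact absurd (e'.trans e.symm) hne
  -- first vertex of a leg
  let nx : Fin 2 → Fin 4 → V ⊕ GT := fun c i =>
    if kk c i = 0 then Sum.inl (C.b i) else Sum.inr (c, some (i, 0))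
  have Jy1 : ∀ c i, i ∈ J c → kk c i = 2 → ∃ q, W.Adj (Sum.inr (c, some (i, 1))) q := by
    intro c i hi h2
    have := ((memJ c i).1 hi).2
    simp only [gEnd, h2] at this
    exact ⟨_, (by simpa using this.symm)⟩
  have Jy0 : ∀ c i, i ∈ J c → (kk c i = 1 ∨ kk c i = 2) →
      ∃ q, W.Adj (Sum.inr (c, some (i, 0))) q := by
    intro c i hi h2
    rcases h2 with h2 | h2
    · have := ((memJ c i).1 hi).2
      simp only [gEnd, h2] at this
      exact ⟨_, (by simpa using this.symm)⟩
    · exact ⟨_, (y1J c i (Jy1 c i hi h2)).2.2.symm⟩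
  have Jnx : ∀ c i, i ∈ J c → W.Adj (Sum.inr (c, none)) (nx c i) := by
    intro c i hi
    have h1 := (memJ c i).1 hi
    by_cases h2 : kk c i = 0
    · have := h1.2
      simp only [gEnd, h2] at this
      simp only [nx, h2]; simpa using this.symm
    · simp only [nx, h2]
      exact (y0J c i (Jy0 c i hi (by omega))).2.2.1.symm
  have nxJ : ∀ c q, W.Adj (Sum.inr (c, none)) q → ∃ i ∈ J c, q = nx c i := by
    intro c q hq
    obtain ⟨i, ⟨hi, rfl⟩ | ⟨hi, rfl⟩⟩ := nbZ c q hq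
    · refine ⟨i, ?_, by simp [nx, hi]⟩
      rw [memJ]; refine ⟨by omega, ?_⟩
      simp only [gEnd, hi]; simpa using hq.symm
    · refine ⟨i, (y0J c i ⟨_, hq.symm⟩).2.1, ?_⟩
      have : kk c i ≠ 0 := by omega
      simp [nx, this]
  have J2 : ∀ c, (J c).Nonempty → 2 ≤ (J c).card := by
    rintro c ⟨i, hi⟩
    obtain ⟨q, hne, hq⟩ := hS.deg2 _ _ (Jnx c i hi)
    obtain ⟨i', hi', rfl⟩ := nxJ c q hq
    have : i' ≠ i := by rintro rfl; exact hne rfl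
    exact Finset.one_lt_card.2 ⟨i', hi', i, hi, this⟩
  have Jle : ∀ c, ∀ i ∈ J c, kk c i ≤ 2 := fun c i hi => ((memJ c i).1 hi).1
  -- the parts of the support
  let Z : Finset V := Finset.univ.filter (fun v => Sum.inl v ∈ S)
  let T : Finset GT := Finset.univ.filter (fun t => Sum.inr t ∈ S)
  have hZT : S = Z.disjSum T := by
    ext x; rcases x with x | x <;> simp [Z, T]
  have memZ : ∀ u, u ∈ Z ↔ ∃ q, W.Adj (Sum.inl u) q := by
    intro u; simp only [Z, Finset.mem_filter, Finset.mem_univ, true_and]; exact hS.mem _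
  have memT : ∀ u, u ∈ T ↔ ∃ q, W.Adj (Sum.inr u) q := by
    intro u; simp only [T, Finset.mem_filter, Finset.mem_univ, true_and]; exact hS.mem _
  have hZD : ∀ z ∈ Z, ¬ C.InD z := by
    intro z hz
    obtain ⟨q, hq⟩ := (memZ z).1 hz
    have := hWH hq
    rcases q with u | t
    · exact this.1
    · obtain ⟨c, i, _, rfl, _⟩ := gCon_end this
      exact bD i
  -- the gadget part
  have hT : T = Finset.univ.filter (fun t : GT => match t with
      | (c, none) => (J c).Nonempty
      | (c, some (i, l)) => i ∈ J c ∧ l.val < kk c i) := by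
    ext ⟨c, _ | ⟨i, l⟩⟩
    · rw [memT]
      simp only [Finset.mem_filter, Finset.mem_univ, true_and]
      constructor
      · rintro ⟨q, hq⟩; obtain ⟨i, hi, _⟩ := nxJ c q hq; exact ⟨i, hi⟩
      · rintro ⟨i, hi⟩; exact ⟨_, Jnx c i hi⟩
    · rw [memT]
      simp only [Finset.mem_filter, Finset.mem_univ, true_and]
      have hl : l = 0 ∨ l = 1 := by revert l; decide
      rcases hl with rfl | rfl
      · constructor
        · intro hq; have := y0J c i hq; exact ⟨this.2.1, by simp; omega⟩
        · rintro ⟨hi, hl⟩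
          have := Jle c i hi
          simp at hl
          exact Jy0 c i hi (by omega)
      · constructor
        · intro hq; have := y1J c i hq; exact ⟨this.2.1, by simp; omega⟩
        · rintro ⟨hi, hl⟩
          have := Jle c i hi
          simp at hl
          exact Jy1 c i hi (by omega)
  have hsumA : ∀ c, (∑ i, ∑ l : Fin 2, if i ∈ J c ∧ l.val < kk c i then 1 else 0)
      = ∑ i ∈ J c, kk c i := by
    intro c
    rw [← Finset.sum_filter_add_sum_filter_not Finset.univ (fun i => i ∈ J c)]
    have e2 : ∑ i ∈ Finset.univ.filter (fun i => ¬ i ∈ J c),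
        (∑ l : Fin 2, if i ∈ J c ∧ l.val < kk c i then 1 else 0) = 0 := by
      apply Finset.sum_eq_zero
      intro i hi
      simp only [Finset.mem_filter] at hi
      simp [hi.2]
    rw [e2, add_zero]
    have e3 : Finset.univ.filter (fun i => i ∈ J c) = J c := by ext; simp
    rw [e3]
    apply Finset.sum_congr rfl
    intro i hi
    have hle := Jle c i hi
    simp only [hi, true_and, Fin.sum_univ_two, Fin.val_zero, Fin.val_one]
    interval_cases kk c i <;> simp
  have hTcard : T.card = ∑ c, ((if (J c).Nonempty then 1 else 0) + ∑ i ∈ J c, kk c i) := by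
    rw [hT, Finset.card_filter, Fintype.sum_prod_type]
    apply Finset.sum_congr rfl
    intro c _
    rw [Fintype.sum_option, Fintype.sum_prod_type]
    refine congrArg₂ (· + ·) ?_ ?_
    · congr!
    · rw [← hsumA c]; congr!
  have hrc1 : rc (fun a b => W.Adj (Sum.inl a) (Sum.inr b)) Z T ≤ ∑ c, (J c).card := by
    unfold rc
    have : (Z ×ˢ T).filter (fun p => W.Adj (Sum.inl p.1) (Sum.inr p.2)) ⊆
        (Finset.univ.sigma (fun c => J c)).image (fun x => (C.b x.2, gEnd kk x.1 x.2)) := by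
      rintro ⟨u, t⟩ hp
      simp only [Finset.mem_filter, Finset.mem_product] at hp
      obtain ⟨c, i, hle, rfl, rfl⟩ := gCon_end (hWH hp.2)
      refine Finset.mem_image.2 ⟨⟨c, i⟩, ?_, rfl⟩
      simp only [Finset.mem_sigma, Finset.mem_univ, true_and]
      exact (memJ c i).2 ⟨hle, hp.2⟩
    refine (Finset.card_le_card this).trans (Finset.card_image_le.trans ?_)
    rw [Finset.card_sigma]
  have hrc2 : rc (fun a b => W.Adj (Sum.inr a) (Sum.inr b)) T T ≤ 2 * ∑ c, ∑ i ∈ J c, kk c i := by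
    unfold rc
    let A : Finset (Fin 2 × Fin 4 × Fin 2) :=
      Finset.univ.filter (fun x => x.2.1 ∈ J x.1 ∧ x.2.2.val < kk x.1 x.2.1)
    have hA : A.card = ∑ c, ∑ i ∈ J c, kk c i := by
      simp only [A]
      rw [Finset.card_filter, Fintype.sum_prod_type]
      apply Finset.sum_congr rfl
      intro c _
      rw [Fintype.sum_prod_type, ← hsumA c]
    let prv : Fin 2 × Fin 4 × Fin 2 → GT := fun x =>
      if x.2.2 = 0 then (x.1, none) else (x.1, some (x.2.1, 0))
    let cur : Fin 2 × Fin 4 × Fin 2 → GT := fun x => (x.1, some (x.2.1, x.2.2))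
    have key : ∀ t t', gInt kk t t' → t' ∈ T → ∃ x ∈ A, t = prv x ∧ t' = cur x := by
      intro t t' hi ht'
      obtain ⟨c, i, l, hl, hle, rfl, rfl⟩ := gInt_pair hi
      refine ⟨(c, i, l), ?_, rfl, rfl⟩
      rw [hT] at ht'
      simpa [A] using ht'
    have : (T ×ˢ T).filter (fun p => W.Adj (Sum.inr p.1) (Sum.inr p.2)) ⊆
        A.image (fun x => (prv x, cur x)) ∪ A.image (fun x => (cur x, prv x)) := by
      rintro ⟨t, t'⟩ hp
      simp only [Finset.mem_filter, Finset.mem_product] at hp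
      rw [Finset.mem_union]
      rcases hWH hp.2 with hi | hi
      · obtain ⟨x, hx, rfl, rfl⟩ := key _ _ hi hp.1.2
        exact Or.inl (Finset.mem_image.2 ⟨x, hx, rfl⟩)
      · obtain ⟨x, hx, rfl, rfl⟩ := key _ _ hi hp.1.1
        exact Or.inr (Finset.mem_image.2 ⟨x, hx, rfl⟩)
    refine (Finset.card_le_card this).trans ((Finset.card_union_le _ _).trans ?_)
    have e1 := Finset.card_image_le (s := A) (f := fun x => (prv x, cur x))
    have e2 := Finset.card_image_le (s := A) (f := fun x => (cur x, prv x))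
    omega
  have hrc0 : rc (fun a b => W.Adj (Sum.inl a) (Sum.inl b)) Z Z ≤ ee G Z Z := by
    refine rc_mono ?_
    intro a _ b _ hab
    exact (hWH hab).2.2
  have hPW := PP_disjSum W Z T
  rw [← hZT] at hPW
  have hcost : gCost kk J = - 5 * (T.card : ℤ) + 4 * ((∑ c, (J c).card : ℕ) : ℤ)
      + 4 * ((∑ c, ∑ i ∈ J c, kk c i : ℕ) : ℤ) := by
    rw [hTcard]
    unfold gCost
    push_cast
    rw [Finset.mul_sum, Finset.mul_sum, Finset.mul_sum, ← Finset.sum_add_distrib,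
      ← Finset.sum_add_distrib]
    apply Finset.sum_congr rfl
    intro c _
    rw [Finset.sum_sub_distrib]
    by_cases hc : (J c).Nonempty
    · simp only [hc, if_true, Finset.sum_const, nsmul_eq_mul]
      ring
    · rw [if_neg hc, if_neg hc]
      rw [Finset.not_nonempty_iff_eq_empty] at hc
      rw [hc]; simp
  have hmain : PP G Z ≤ PP W S + gCost kk J := by
    have h6 : PP G Z = 5 * (Z.card : ℤ) - 2 * (ee G Z Z : ℤ) := rfl
    zify at hrc0 hrc1 hrc2
    push_cast at hcost
    linarith
  -- some leg is used
  have hJne : (J 0 ∪ J 1).Nonempty := by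
    by_contra hcon
    have hJ : ∀ c, J c = ∅ := by
      rw [Finset.not_nonempty_iff_eq_empty, Finset.union_eq_empty] at hcon
      intro c
      have hc : c = 0 ∨ c = 1 := by revert c; decide
      rcases hc with rfl | rfl
      · exact hcon.1
      · exact hcon.2
    have hT0 : ∀ t, t ∉ T := by
      intro t ht
      have : T.card = 0 := by rw [hTcard]; simp [hJ]
      rw [Finset.card_eq_zero] at this
      rw [this] at ht; simp at ht
    obtain ⟨g, hg⟩ := sub_col h.1 (C.D)ᶜ (C.v 0) (by
      simp only [Finset.mem_compl, not_not, C.mem_D]; exact Or.inl ⟨0, rfl⟩)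
    apply hS.ncol
    refine ⟨Sum.elim g (fun _ => 0), ?_⟩
    rintro (u | t) (u' | t') hq
    · have := hWH hq
      exact hg u (by simpa [C.mem_D] using this.1) u' (by simpa [C.mem_D] using this.2.1) this.2.2
    · exact absurd ((memT t').2 ⟨_, hq.symm⟩) (hT0 t')
    · exact absurd ((memT t).2 ⟨_, hq⟩) (hT0 t)
    · exact absurd ((memT t).2 ⟨_, hq⟩) (hT0 t)
  have hbZ : ∀ i ∈ J 0 ∪ J 1, C.b i ∈ Z := by
    intro i hi
    rw [memZ]
    rcases Finset.mem_union.1 hi with hi | hi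
    · exact ⟨_, ((memJ _ _).1 hi).2⟩
    · exact ⟨_, ((memJ _ _).1 hi).2⟩
  have hZne : Z.Nonempty := by
    obtain ⟨i, hi⟩ := hJne; exact ⟨_, hbZ i hi⟩
  have hLB := C.LB h hk0 Z hZD hZne _ hbZ
  have hcardS : S.card < Fintype.card V := by
    have e1 : S.card = Z.card + T.card := by rw [hZT, Finset.card_disjSum]
    have e2 : Disjoint Z C.D := by
      rw [Finset.disjoint_left]; intro x hx hx'; exact hZD x hx (C.mem_D.1 hx')
    have e3 := Finset.card_union_of_disjoint e2
    have e4 : (Z ∪ C.D).card ≤ Fintype.card V := Finset.card_le_univ _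
    have e5 : 10 ≤ C.D.card := by
      rw [C.card_D, Fin.sum_univ_four, hk0]
      have hk1 : ∀ i, 1 ≤ C.k i := fun i => by rcases C.hk i with h | h <;> omega
      have a1 := hk1 1
      have a2 := hk1 2
      have a3 := hk1 3
      omega
    have e6 : T.card ≤ 9 := by
      rw [hTcard]
      refine le_trans (Finset.sum_le_sum ?_) hsize
      intro c _
      apply Nat.add_le_add
      · split_ifs <;> simp
      · have : ∑ i ∈ J c, kk c i = ∑ i ∈ J c, (if kk c i ≤ 2 then kk c i else 0) :=
          Finset.sum_congr rfl (fun i hi => by rw [if_pos (Jle c i hi)])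
        rw [this]
        exact Finset.sum_le_sum_of_subset (Finset.subset_univ _)
    omega
  obtain ⟨ha1, ha2⟩ := hadm J Jle J2 hJne
  rcases hS.small hcardS with h' | ⟨_, _, x, y, z, hx, hy, hz⟩ | ⟨h', hd⟩
  · linarith
  · exact gH_notri C kk hΔ h0 h1 x y z (hWH hx) (hWH hy) (hWH hz)
  · have := ha2 (by
      intro c
      have hinj : Set.InjOn (nx c) (J c : Set (Fin 4)) := by
        intro i hi i' hi' hii
        by_contra hne
        by_cases e1 : kk c i = 0 <;> by_cases e2 : kk c i' = 0 <;> simp [nx, e1, e2] at hii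
        · exact (h0 c i i' hne e1 e2).1 hii
        · exact hne hii
      have := hd (Sum.inr (c, none)) ((J c).image (nx c)) (by
        intro v hv
        obtain ⟨i, hi, rfl⟩ := Finset.mem_image.1 hv
        exact Jnx c i hi)
      rwa [Finset.card_image_of_injOn hinj] at this)
    linarith

end CellProof

namespace CellProof
set_option linter.unusedSectionVars false
set_option linter.unusedSimpArgs false

/-! Sets of 4-tuples over `Fin 5` as 625-bit masks. -/

def idx (f : Fin 4 → Fin 5) : ℕ :=
  (f 0).val + 5 * (f 1).val + 25 * (f 2).val + 125 * (f 3).val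

lemma idx_lt (f : Fin 4 → Fin 5) : idx f < 625 := by
  unfold idx; omega

def mAtom (i : Fin 4) (a : Fin 5) : ℕ :=
  ((2 ^ (5 ^ i.val) - 1) * 2 ^ (a.val * 5 ^ i.val)) *
    ((2 ^ 625 - 1) / (2 ^ (5 ^ (i.val + 1)) - 1))

/-- The mask `m` represents the predicate `P`. -/
def Rep (m : ℕ) (P : (Fin 4 → Fin 5) → Prop) : Prop := ∀ f, m.testBit (idx f) = true ↔ P f

lemma mAtom_aux : ∀ i : Fin 4, ∀ a x y z w : Fin 5,
    ((mAtom i a).testBit (x.val + 5 * y.val + 25 * z.val + 125 * w.val)) =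
      decide (![x, y, z, w] i = a) := by
  decide +kernel

lemma rep_atom (i : Fin 4) (a : Fin 5) : Rep (mAtom i a) (fun f => f i = a) := by
  intro f
  have := mAtom_aux i a (f 0) (f 1) (f 2) (f 3)
  unfold idx
  rw [this]
  have e : ![f 0, f 1, f 2, f 3] = f := by ext x; fin_cases x <;> rfl
  rw [e]; simp

def mTop : ℕ := 2 ^ 625 - 1

lemma rep_or {m n P Q} (h : Rep m P) (h' : Rep n Q) : Rep (m ||| n) (fun f => P f ∨ Q f) := by
  intro f; rw [Nat.testBit_or, Bool.or_eq_true, h f, h' f]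
lemma rep_and {m n P Q} (h : Rep m P) (h' : Rep n Q) : Rep (m &&& n) (fun f => P f ∧ Q f) := by
  intro f; rw [Nat.testBit_and, Bool.and_eq_true, h f, h' f]
lemma top_bit (f) : mTop.testBit (idx f) = true := by
  unfold mTop; rw [Nat.testBit_two_pow_sub_one]; simpa using idx_lt f
lemma rep_not {m P} (h : Rep m P) : Rep (mTop ^^^ m) (fun f => ¬ P f) := by
  intro f
  change _ ↔ ¬ P f
  rw [Nat.testBit_xor, top_bit, ← h f]; simp
lemma rep_if {m P} (b : Bool) (h : b = true → Rep m P) :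
    Rep (bif b then m else 0) (fun f => b = true ∧ P f) := by
  cases b
  · intro f; simp
  · intro f; simpa using h rfl f
lemma rep_taut {m P} (h : Rep m P) (hm : Nat.beq m mTop = true) : ∀ f, P f := by
  intro f
  have := Nat.eq_of_beq_eq_true hm
  rw [← h f, this]; exact top_bit f

def or5 (m : Fin 5 → ℕ) : ℕ := m 0 ||| (m 1 ||| (m 2 ||| (m 3 ||| m 4)))
def and4 (m : Fin 4 → ℕ) : ℕ := m 0 &&& (m 1 &&& (m 2 &&& m 3))
lemma rep_or5 {m : Fin 5 → ℕ} {P : Fin 5 → (Fin 4 → Fin 5) → Prop} (h : ∀ a, Rep (m a) (P a)) :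
    Rep (or5 m) (fun f => ∃ a, P a f) := by
  intro f
  unfold or5
  simp only [Nat.testBit_or, Bool.or_eq_true, (h _) f, Fin.exists_fin_succ, Fin.exists_fin_zero,
    or_false]
  rfl
lemma rep_and4 {m : Fin 4 → ℕ} {P : Fin 4 → (Fin 4 → Fin 5) → Prop} (h : ∀ a, Rep (m a) (P a)) :
    Rep (and4 m) (fun f => ∀ a, P a f) := by
  intro f
  unfold and4
  simp only [Nat.testBit_and, Bool.and_eq_true, (h _) f, Fin.forall_fin_succ, Fin.forall_fin_zero,
    and_true]
  rfl

/-- mask of `R k x (f i)` -/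
def mR (k : ℕ) (x : Fin 5) (i : Fin 4) : ℕ := or5 (fun a => bif R k x a then mAtom i a else 0)
lemma rep_R (k x i) : Rep (mR k x i) (fun f => R k x (f i) = true) := by
  intro f
  unfold mR
  rw [rep_or5 (fun a => rep_if (R k x a) (fun _ => rep_atom i a)) f]
  constructor
  · rintro ⟨a, h, rfl⟩; exact h
  · intro h; exact ⟨_, h, rfl⟩

/-- mask of `f i = f j` -/
def mEq (i j : Fin 4) : ℕ := or5 (fun a => mAtom i a &&& mAtom j a)
lemma rep_eq (i j) : Rep (mEq i j) (fun f => f i = f j) := by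
  intro f
  unfold mEq
  rw [rep_or5 (fun a => rep_and (rep_atom i a) (rep_atom j a)) f]
  constructor
  · rintro ⟨a, h, h'⟩; rw [h, h']
  · intro h; exact ⟨_, rfl, h.symm⟩

/-- mask of `f i ~ f j` -/
def mAdj (i j : Fin 4) : ℕ := or5 (fun a => mAtom i a &&& mR 0 a j)
lemma rep_adj (i j) : Rep (mAdj i j) (fun f => A5 (f i) (f j)) := by
  intro f
  unfold mAdj
  rw [rep_or5 (fun a => rep_and (rep_atom i a) (rep_R 0 a j)) f]
  constructor
  · rintro ⟨a, rfl, h'⟩; exact R0.1 h'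
  · intro h; exact ⟨_, rfl, R0.2 h⟩

/-- tuples satisfying a star -/
def Star (kk : Fin 4 → ℕ) (f : Fin 4 → Fin 5) : Prop := ∃ z, ∀ i, R (kk i) z (f i) = true
def mStar (kk : Fin 4 → ℕ) : ℕ := or5 (fun z => and4 (fun i => mR (kk i) z i))
lemma rep_star (kk) : Rep (mStar kk) (Star kk) :=
  rep_or5 (fun z => rep_and4 (fun i => rep_R (kk i) z i))

/-- tuples that extend to the cell -/
def Good (ks : Fin 4 → ℕ) (js : Fin 4 → Fin 5) (f : Fin 4 → Fin 5) : Prop :=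
  ∃ s, (∀ i, R (ks i) (s + js i) (f i) = true) ∨ (∀ i, R (ks i) (s - js i) (f i) = true)
def mGood (ks : Fin 4 → ℕ) (js : Fin 4 → Fin 5) : ℕ :=
  or5 (fun s => and4 (fun i => mR (ks i) (s + js i) i) ||| and4 (fun i => mR (ks i) (s - js i) i))
lemma rep_good (ks js) : Rep (mGood ks js) (Good ks js) :=
  rep_or5 (fun _ => rep_or (rep_and4 (fun _ => rep_R _ _ _)) (rep_and4 (fun _ => rep_R _ _ _)))


def taut (m : ℕ) : Bool := Nat.beq m mTop

/-! Strategies. -/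

inductive Strat
  | empty
  | s1 (i j k : Fin 4)
  | s2 (c d e : Fin 4)
  | star (a b c d : ℕ)
  | s4 (i j k : Fin 4)

def side (ks : Fin 4 → ℕ) (g : ℕ) (c x : Fin 4) : Bool :=
  Nat.beq (ks c + ks x) 2 || [c, x].any fun p => [0, 1, 2, 3].any fun o =>
    Nat.beq (ks p) 1 && (Nat.beq (ks o) 1 && (decide (o ≠ c) && (decide (o ≠ x) &&
      (Nat.ble (ks c + ks x + ks o) 4 && taut (g ||| ((mTop ^^^ mEq c x) ||| mAdj p o))))))

def chk (ks : Fin 4 → ℕ) (g : ℕ) : Strat → Bool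
  | .empty => taut g
  | .s1 i j k => taut (g ||| (mEq i j &&& mEq i k))
  | .s2 c d e => taut (g ||| (mEq c d ||| mEq c e)) && (side ks g c d && side ks g c e)
  | .star a b c d => taut (g ||| (mTop ^^^ mStar ![a, b, c, d]))
  | .s4 i j k => taut (g ||| (mEq j k ||| mEq 0 i)) &&
      taut (g ||| ((mTop ^^^ (mEq 0 i &&& (mTop ^^^ mEq j k))) ||| (mAdj i j &&& mAdj i k)))

def KS : Fin 4 → Fin 4 → ℕ := ![![2, 2, 2, 2], ![2, 2, 2, 1], ![2, 2, 1, 1], ![2, 1, 1, 1]]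

def strats : Fin 4 → List Strat := ![
  [.empty],
  [.empty, .s1 0 1 3, .s1 0 2 3, .s1 1 2 3, .star 2 2 3 0, .star 3 2 1 1, .star 2 3 1 1,
   .star 2 3 2 0, .star 1 3 2 1, .star 3 2 2 0, .star 2 2 2 1],
  [.empty, .s1 0 1 2, .s1 0 1 3, .s1 0 2 3, .s1 1 2 3, .s2 0 2 3, .s2 1 2 3, .s2 2 0 3,
   .s2 2 1 3, .s2 3 0 2, .s2 3 1 2, .star 3 2 1 0, .star 3 2 0 1, .star 2 2 1 1,
   .star 2 2 0 2, .star 2 3 1 0, .star 2 3 0 1, .star 2 2 1 2, .star 2 2 2 1,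
   .star 2 2 3 0, .star 3 1 1 1],
  [.empty, .s1 0 1 2, .s1 0 1 3, .s1 0 2 3, .s1 1 2 3, .s2 0 1 2, .s2 0 1 3, .s2 0 2 3,
   .s2 1 0 2, .s2 1 0 3, .s2 1 2 3, .s2 2 0 1, .s2 2 0 3, .s2 2 1 3, .s2 3 0 1,
   .s2 3 0 2, .s2 3 1 2, .star 3 0 1 1, .star 3 1 0 1, .star 3 1 1 0, .star 2 1 1 1,
   .star 2 1 0 2, .star 2 0 1 2, .star 1 1 1 3, .star 2 0 2 1, .star 1 1 3 1,
   .star 1 3 1 1, .star 2 1 1 2, .star 2 1 2 1, .star 2 1 2 0, .star 2 2 1 1,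
   .star 2 2 1 0, .star 2 2 0 1, .s4 1 2 3, .s4 2 1 3, .s4 3 1 2]]

set_option maxRecDepth 10000 in
theorem check_all : ∀ q : Fin 4, ∀ a b c : Fin 5,
    (strats q).any (chk (KS q) (mGood (KS q) ![0, a, b, c])) = true := by
  decide +kernel

end CellProof

namespace CellProof
set_option linter.unusedSectionVars false
set_option linter.unusedSimpArgs false

def cost1 (s : Fin 4 → ℕ) (J : Finset (Fin 4)) : ℤ :=
  if J.Nonempty then -5 + ∑ i ∈ J, (4 - (s i : ℤ)) else 0

/-- the numerical hypotheses of the gadget lemma -/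
def Adm (ks s0 s1 : Fin 4 → ℕ) : Prop :=
  ((1 + ∑ i, if s0 i ≤ 2 then s0 i else 0) + (1 + ∑ i, if s1 i ≤ 2 then s1 i else 0) ≤ 9) ∧
  ∀ J0 : Finset (Fin 4), (∀ i ∈ J0, s0 i ≤ 2) → (J0.Nonempty → 2 ≤ J0.card) →
  ∀ J1 : Finset (Fin 4), (∀ i ∈ J1, s1 i ≤ 2) → (J1.Nonempty → 2 ≤ J1.card) →
    (J0 ∪ J1).Nonempty →
      cost1 s0 J0 + cost1 s1 J1 + 1 < LBf ks (J0 ∪ J1) ∧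
      (J0.card ≤ 3 → J1.card ≤ 3 → cost1 s0 J0 + cost1 s1 J1 + 2 < LBf ks (J0 ∪ J1))

instance (ks s0 s1) : Decidable (Adm ks s0 s1) := by unfold Adm; infer_instance

def E3 : Fin 4 → ℕ := fun _ => 3
def lnkN (i j : Fin 4) : Fin 4 → ℕ := fun x => if x = i then 0 else if x = j then 1 else 3
def lnkA (i j : Fin 4) : Fin 4 → ℕ := fun x => if x = i ∨ x = j then 0 else 3

/-- per-strategy side conditions not depending on the positions -/
def admS (ks : Fin 4 → ℕ) : Strat → Prop
  | .empty => True
  | .s1 i j k => i ≠ j ∧ i ≠ k ∧ j ≠ k ∧ ks i + ks j + ks k ≤ 5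
  | .s2 c d e => c ≠ d ∧ c ≠ e ∧ Adm ks (lnkN c d) (lnkN c e)
  | .star a b c d => Adm ks ![a, b, c, d] E3 ∧
      (∀ i j, i ≠ j → ![a, b, c, d] i = 0 → ![a, b, c, d] j ≠ 0) ∧
      (∀ i j, ![a, b, c, d] i = 0 → ![a, b, c, d] j = 1 → ks i = 1 ∧ ks j = 1)
  | .s4 i j k => ks i = 1 ∧ ks j = 1 ∧ ks k = 1 ∧ ks 0 = 2 ∧ i ≠ j ∧ i ≠ k ∧ j ≠ k ∧
      Adm ks (lnkN j k) (lnkN 0 i) ∧ Adm ks (lnkA i j) (lnkN j k) ∧ Adm ks (lnkA i k) (lnkN j k)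

instance (ks s) : Decidable (admS ks s) := by cases s <;> unfold admS <;> infer_instance

set_option maxRecDepth 10000 in
theorem admS_all : ∀ q : Fin 4, ∀ s ∈ strats q, admS (KS q) s := by decide +kernel

set_option maxRecDepth 10000 in
theorem admN : ∀ q i j : Fin 4, i ≠ j → Adm (KS q) (lnkN i j) E3 := by decide +kernel

set_option maxRecDepth 10000 in
theorem admA : ∀ q i j : Fin 4, i ≠ j → KS q i = 1 → KS q j = 1 → Adm (KS q) (lnkA i j) E3 := by
  decide +kernel

theorem admE : ∀ q : Fin 4, Adm (KS q) E3 E3 := by decide +kernel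
end CellProof

namespace CellProof
set_option linter.unusedSectionVars false
set_option linter.unusedSimpArgs false

section
variable {V : Type} [Fintype V] {G : SimpleGraph V}

lemma no_triangle (h : SmallestCex G) (h4 : 4 ≤ Fintype.card V) :
    ∀ x y z, G.Adj x y → G.Adj y z → G.Adj z x → False := by
  classical
  intro x y z hxy hyz hzx
  have e1 := PP_insert G {z} {z} y (by simpa using hyz.ne) (by simp) (by simpa using hyz)
  have e2 := PP_insert G {y, z} {y, z} x
    (by simp only [Finset.mem_insert, Finset.mem_singleton, not_or]; exact ⟨hxy.ne, hzx.ne'⟩)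
    (by simp) (by simp only [Finset.mem_insert, Finset.mem_singleton, forall_eq_or_imp, forall_eq]
                  exact ⟨hxy, hzx.symm⟩)
  rw [PP_singleton] at e1
  rw [Finset.card_singleton] at e1
  rw [Finset.card_pair hyz.ne] at e2
  have hcard : ({x, y, z} : Finset V).card ≤ 3 := Finset.card_le_three
  obtain ⟨w, hw⟩ : ∃ w, w ∉ ({x, y, z} : Finset V) := by
    by_contra! hc
    have : ({x, y, z} : Finset V) = Finset.univ := by ext; simp [hc]
    rw [this, Finset.card_univ] at hcard; omega
  have := P4 h {x, y, z} (by simp) w hw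
  push_cast at e1 e2
  omega

def okS (C : Cell G) (s : Fin 4 → ℕ) : Prop :=
  (∀ i j, i ≠ j → s i = 0 → s j = 0 → C.b i ≠ C.b j ∧ ¬ G.Adj (C.b i) (C.b j)) ∧
  (∀ i j, s i = 0 → s j = 1 → C.b i ≠ C.b j)

lemma not_good (h : SmallestCex G) (C : Cell G) (g : V → Fin 5)
    (hg : ∀ u u', ¬ C.InD u → ¬ C.InD u' → G.Adj u u' → A5 (g u) (g u')) :
    ¬ Good C.k C.j (fun i => g (C.b i)) := by
  rintro ⟨s, hs | hs⟩
  · refine crit_ncol h.1 (C.extend (fun t => s + t) ?_ g hg hs)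
    clear hs; intro t t' ht; revert s t t'; decide
  · refine crit_ncol h.1 (C.extend (fun t => s - t) ?_ g hg hs)
    clear hs; intro t t' ht; revert s t t'; decide

lemma gad (h : SmallestCex G) (C : Cell G) (hk0 : C.k 0 = 2)
    (hΔ : ∀ x y z, G.Adj x y → G.Adj y z → G.Adj z x → False)
    (s0 s1 : Fin 4 → ℕ) (hA : Adm C.k s0 s1) (h0 : okS C s0) (h1 : okS C s1) :
    ∃ f, ¬ Good C.k C.j f ∧ Star s0 f ∧ Star s1 f ∧ ∀ i j, C.b i = C.b j → f i = f j := by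
  obtain ⟨g, hg, hs⟩ := gadget h C hk0 hΔ ![s0, s1]
    (by intro c; fin_cases c
        · exact h0.1
        · exact h1.1)
    (by intro c; fin_cases c
        · exact h0.2
        · exact h1.2)
    (by rw [Fin.sum_univ_two]; exact hA.1)
    (by intro J hJ hJ2 hne
        have := hA.2 (J 0) (hJ 0) (hJ2 0) (J 1) (hJ 1) (hJ2 1) hne
        have e : gCost ![s0, s1] J = cost1 s0 (J 0) + cost1 s1 (J 1) := by
          unfold gCost cost1; rw [Fin.sum_univ_two]; rfl
        rw [e]
        exact ⟨this.1, fun hc => this.2 (hc 0) (hc 1)⟩)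
  exact ⟨_, not_good h C g hg, hs 0, hs 1, fun i j e => by rw [e]⟩

lemma okE (C : Cell G) : okS C E3 := by
  constructor <;> intro i j <;> simp [E3]

lemma okN (C : Cell G) (i j : Fin 4) (hij : C.b i ≠ C.b j) : okS C (lnkN i j) := by
  constructor
  · intro a b hab ha hb
    unfold lnkN at ha hb
    split_ifs at ha hb with h1 h2 <;> simp_all
  · intro a b ha hb
    unfold lnkN at ha hb
    split_ifs at ha hb <;> simp_all

lemma okA (C : Cell G) (i j : Fin 4) (hij : C.b i ≠ C.b j) (hA : ¬ G.Adj (C.b i) (C.b j)) :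
    okS C (lnkA i j) := by
  have hij' := hij.symm
  have hA' : ¬ G.Adj (C.b j) (C.b i) := fun h => hA h.symm
  constructor
  · intro a b hab ha hb
    unfold lnkA at ha hb
    have h1 : a = i ∨ a = j := by by_contra hc; rw [if_neg hc] at ha; omega
    have h2 : b = i ∨ b = j := by by_contra hc; rw [if_neg hc] at hb; omega
    rcases h1 with rfl | rfl <;> rcases h2 with rfl | rfl <;> simp_all
  · intro a b ha hb
    unfold lnkA at ha hb
    split_ifs at ha hb; omega

lemma starN {i j : Fin 4} (hij : i ≠ j) {f} (hs : Star (lnkN i j) f) : f i ≠ f j := by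
  obtain ⟨z, hz⟩ := hs
  have h1 := hz i
  have h2 := hz j
  simp only [lnkN, if_true, if_neg hij.symm] at h1 h2
  clear hz
  generalize f i = x at *
  generalize f j = y at *
  revert z x y; decide

lemma starA {i j : Fin 4} {f} (hs : Star (lnkA i j) f) : ¬ A5 (f i) (f j) := by
  obtain ⟨z, hz⟩ := hs
  have h1 := hz i
  have h2 := hz j
  simp only [lnkA, true_or, or_true, if_true] at h1 h2
  clear hz
  generalize f i = x at *
  generalize f j = y at *
  revert z x y; decide

lemma b_notD (C : Cell G) (i : Fin 4) : ¬ C.InD (C.b i) := by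
  rintro (⟨t, ht⟩ | ⟨i', l, ht⟩)
  · exact C.bv _ _ ht
  · exact C.bny _ _ _ ht

lemma LBf3 (k : Fin 4 → ℕ) (i j l : Fin 4) (h1 : i ≠ j) (h2 : i ≠ l) (h3 : j ≠ l) :
    LBf k {i, j, l} = 11 - ((k i + k j + k l : ℕ) : ℤ) := by
  have hc : ({i, j, l} : Finset (Fin 4)).card = 3 := Finset.card_eq_three.2 ⟨_, _, _, h1, h2, h3, rfl⟩
  unfold LBf
  rw [if_neg (by rw [hc]; omega), if_pos hc, Finset.sum_insert (by simp [h1, h2]),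
    Finset.sum_pair h3, add_assoc]

lemma one_one (h : SmallestCex G) (C : Cell G) (hk0 : C.k 0 = 2) {i j : Fin 4} (hij : i ≠ j)
    (hs : C.k i + C.k j = 2) : C.b i ≠ C.b j := by
  classical
  intro he
  have := Cell.LB h C hk0 {C.b i} (by simpa using b_notD C i) (by simp) {i, j}
    (by simp [he])
  rw [PP_singleton] at this
  unfold LBf at this
  rw [if_pos ⟨Finset.card_pair hij, by rw [Finset.sum_pair hij]; exact hs⟩] at this
  omega

/-- three ends of total length at most 5 are not all equal -/
lemma three_eq (h : SmallestCex G) (C : Cell G) (hk0 : C.k 0 = 2) {i j l : Fin 4}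
    (h1 : i ≠ j) (h2 : i ≠ l) (h3 : j ≠ l) (hs : C.k i + C.k j + C.k l ≤ 5)
    (he : C.b i = C.b j) (he' : C.b i = C.b l) : False := by
  classical
  have := Cell.LB h C hk0 {C.b i} (by simpa using b_notD C i) (by simp) {i, j, l}
    (by simp [← he, ← he'])
  rw [PP_singleton, LBf3 _ _ _ _ h1 h2 h3] at this
  push_cast at this
  omega

lemma PP_pair (x y : V) (hxy : G.Adj x y) [DecidableEq V] : PP G {x, y} ≤ 6 := by
  have e1 := PP_insert G {y} {y} x (by simpa using hxy.ne) (by simp) (by simpa using hxy)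
  rw [PP_singleton, Finset.card_singleton] at e1
  push_cast at e1; linarith

/-- the situation `b c = b x`, `b o ~ b c` -/
lemma three_adj (h : SmallestCex G) (C : Cell G) (hk0 : C.k 0 = 2) {i j l : Fin 4}
    (h1 : i ≠ j) (h2 : i ≠ l) (h3 : j ≠ l) (hs : C.k i + C.k j + C.k l ≤ 4)
    (he : C.b i = C.b j) (he' : G.Adj (C.b i) (C.b l)) : False := by
  classical
  have := Cell.LB h C hk0 {C.b i, C.b l} (by simp [b_notD]) (by simp) {i, j, l}
    (by simp [← he])
  rw [LBf3 _ _ _ _ h1 h2 h3] at this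
  have := PP_pair _ _ he'
  push_cast at *
  omega

theorem strat_false (h : SmallestCex G) (C : Cell G) (hk0 : C.k 0 = 2)
    (hΔ : ∀ x y z, G.Adj x y → G.Adj y z → G.Adj z x → False)
    (q : Fin 4) (hq : C.k = KS q) (s : Strat) (ha : admS C.k s)
    (hc : chk C.k (mGood C.k C.j) s = true) : False := by
  classical
  have hN : ∀ i j, C.b i ≠ C.b j → ∃ f, ¬ Good C.k C.j f ∧ f i ≠ f j := by
    intro i j hij
    have hne : i ≠ j := fun e => hij (by rw [e])
    obtain ⟨f, h1, h2, _⟩ := gad h C hk0 hΔ _ _ (by rw [hq]; exact admN q i j hne)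
      (okN C i j hij) (okE C)
    exact ⟨f, h1, starN hne h2⟩
  cases s with
  | empty =>
    obtain ⟨f, h1, _⟩ := gad h C hk0 hΔ _ _ (by rw [hq]; exact admE q) (okE C) (okE C)
    exact h1 (rep_taut (rep_good _ _) hc f)
  | s1 i j k =>
    obtain ⟨hij, hik, hjk, hs⟩ := ha
    have ht := rep_taut (rep_or (rep_good _ _) (rep_and (rep_eq i j) (rep_eq i k))) hc
    by_cases e1 : C.b i = C.b j
    · by_cases e2 : C.b i = C.b k
      · exact three_eq h C hk0 hij hik hjk hs e1 e2
      · obtain ⟨f, hf, hf'⟩ := hN _ _ e2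
        rcases ht f with hh | hh
        · exact hf hh
        · exact hf' hh.2
    · obtain ⟨f, hf, hf'⟩ := hN _ _ e1
      rcases ht f with hh | hh
      · exact hf hh
      · exact hf' hh.1
  | s2 c d e =>
    obtain ⟨hcd, hce, hA⟩ := ha
    simp only [chk, Bool.and_eq_true] at hc
    obtain ⟨hc1, hc2, hc3⟩ := hc
    have hside : ∀ x, c ≠ x → side C.k (mGood C.k C.j) c x = true → C.b c ≠ C.b x := by
      intro x hcx hsd hb
      simp only [side, Bool.or_eq_true, List.any_eq_true, Bool.and_eq_true, decide_eq_true_eq] at hsd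
      rcases hsd with hsd | ⟨p, hp, o, _, hp1, ho1, hoc, hox, hle, ht⟩
      · exact one_one h C hk0 hcx (Nat.eq_of_beq_eq_true hsd) hb
      · have hp1 := Nat.eq_of_beq_eq_true hp1
        have ho1 := Nat.eq_of_beq_eq_true ho1
        have hle := Nat.le_of_ble_eq_true hle
        have ht := rep_taut (rep_or (rep_good _ _) (rep_or (rep_not (rep_eq c x)) (rep_adj p o))) ht
        have hpo : p ≠ o := by
          simp only [List.mem_cons, List.not_mem_nil, or_false] at hp
          rintro rfl
          rcases hp with rfl | rfl
          · exact hoc rfl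
          · exact hox rfl
        have hbp : C.b p = C.b c := by
          simp only [List.mem_cons, List.not_mem_nil, or_false] at hp
          rcases hp with rfl | rfl
          · rfl
          · exact hb.symm
        by_cases hadj : G.Adj (C.b p) (C.b o)
        · exact three_adj h C hk0 hcx hoc.symm hox.symm hle hb (hbp ▸ hadj)
        · obtain ⟨f, h1, h2, _, h4⟩ := gad h C hk0 hΔ _ _
            (by rw [hq] at hp1 ho1 ⊢; exact admA q p o hpo hp1 ho1)
            (okA C p o (one_one h C hk0 hpo (by omega)) hadj) (okE C)
          rcases ht f with hh | hh | hh
          · exact h1 hh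
          · exact hh (h4 _ _ hb)
          · exact starA h2 hh
    have ht := rep_taut (rep_or (rep_good _ _) (rep_or (rep_eq c d) (rep_eq c e))) hc1
    obtain ⟨f, h1, h2, h3, _⟩ := gad h C hk0 hΔ _ _ hA (okN C c d (hside d hcd hc2))
      (okN C c e (hside e hce hc3))
    rcases ht f with hh | hh | hh
    · exact h1 hh
    · exact starN hcd h2 hh
    · exact starN hce h3 hh
  | star a b c d =>
    obtain ⟨hA, hz, ho⟩ := ha
    have ht := rep_taut (rep_or (rep_good _ _) (rep_not (rep_star ![a, b, c, d]))) hc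
    obtain ⟨f, h1, h2, _⟩ := gad h C hk0 hΔ _ _ hA
      ⟨fun i j hij hi hj => absurd hj (hz i j hij hi), fun i j hi hj => by
        have := ho i j hi hj
        refine one_one h C hk0 ?_ (by omega)
        rintro rfl; omega⟩ (okE C)
    rcases ht f with hh | hh
    · exact h1 hh
    · exact hh h2
  | s4 i j k =>
    obtain ⟨hi1, hj1, hk1, h02, hij, hik, hjk, hA1, hA2, hA3⟩ := ha
    simp only [chk, Bool.and_eq_true] at hc
    have ht1 := rep_taut (rep_or (rep_good _ _) (rep_or (rep_eq j k) (rep_eq 0 i))) hc.1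
    have ht2 := rep_taut (rep_or (rep_good _ _) (rep_or (rep_not (rep_and (rep_eq 0 i)
      (rep_not (rep_eq j k)))) (rep_and (rep_adj i j) (rep_adj i k)))) hc.2
    have h0i : (0 : Fin 4) ≠ i := by rintro rfl; omega
    have h0j : (0 : Fin 4) ≠ j := by rintro rfl; omega
    have h0k : (0 : Fin 4) ≠ k := by rintro rfl; omega
    have bij := one_one h C hk0 hij (by omega)
    have bik := one_one h C hk0 hik (by omega)
    have bjk := one_one h C hk0 hjk (by omega)
    by_cases e : C.b 0 = C.b i
    · have fin : ∀ f, ¬ Good C.k C.j f → f j ≠ f k → A5 (f i) (f j) ∧ A5 (f i) (f k) := by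
        intro f hf hne
        rcases ht2 f with hh | hh | hh
        · exact absurd hh hf
        · rcases ht1 f with hh' | hh' | hh'
          · exact absurd hh' hf
          · exact absurd hh' hne
          · exact absurd ⟨hh', hne⟩ hh
        · exact hh
      by_cases a1 : G.Adj (C.b i) (C.b j)
      · by_cases a2 : G.Adj (C.b i) (C.b k)
        · have hcard : ({0, i, j, k} : Finset (Fin 4)).card = 4 := by
            rw [Finset.card_insert_of_notMem (by simp [h0i, h0j, h0k]),
              Finset.card_eq_three.2 ⟨_, _, _, hij, hik, hjk, rfl⟩]
          have hsum : ∑ x ∈ ({0, i, j, k} : Finset (Fin 4)), C.k x = 5 := by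
            rw [Finset.sum_insert (by simp [h0i, h0j, h0k]), Finset.sum_insert (by simp [hij, hik]),
              Finset.sum_pair hjk]
            omega
          have hL := Cell.LB h C hk0 {C.b i, C.b j, C.b k} (by simp [b_notD]) (by simp)
            {0, i, j, k} (by simp [e])
          have e1 := PP_insert G {C.b k} ∅ (C.b j) (by simpa using bjk) (by simp) (by simp)
          have e2 := PP_insert G {C.b j, C.b k} {C.b j, C.b k} (C.b i) (by simp [bij, bik])
            (by simp) (by simp [a1, a2])
          rw [Finset.card_pair bjk] at e2
          rw [PP_singleton, Finset.card_empty] at e1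
          unfold LBf at hL
          rw [if_neg (by rw [hcard]; omega), if_neg (by rw [hcard]; omega), if_pos hcard, hsum] at hL
          push_cast at *
          omega
        · obtain ⟨f, h1, h2, h3, _⟩ := gad h C hk0 hΔ _ _ hA3 (okA C i k bik a2) (okN C j k bjk)
          exact starA h2 (fin f h1 (starN hjk h3)).2
      · obtain ⟨f, h1, h2, h3, _⟩ := gad h C hk0 hΔ _ _ hA2 (okA C i j bij a1) (okN C j k bjk)
        exact starA h2 (fin f h1 (starN hjk h3)).1
    · obtain ⟨f, h1, h2, h3, _⟩ := gad h C hk0 hΔ _ _ hA1 (okN C j k bjk) (okN C 0 i e)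
      rcases ht1 f with hh | hh | hh
      · exact h1 hh
      · exact starN hjk h2 hh
      · exact starN h0i h3 hh

theorem cell_false (h : SmallestCex G) (C : Cell G) (q : Fin 4) (hq : C.k = KS q)
    (hj : C.j 0 = 0) : False := by
  classical
  have hk0 : C.k 0 = 2 := by rw [hq]; clear hq; revert q; decide
  have h4 : 4 ≤ Fintype.card V := by
    have := Fintype.card_le_of_injective _ C.vinj
    simp at this; omega
  have hck := check_all q (C.j 1) (C.j 2) (C.j 3)
  have e : ![0, C.j 1, C.j 2, C.j 3] = C.j := by
    ext x; fin_cases x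
    · simp [hj]
    · rfl
    · rfl
    · rfl
  rw [e, List.any_eq_true, ← hq] at hck
  obtain ⟨s, hs, hc⟩ := hck
  exact strat_false h C hk0 (no_triangle h h4) q hq s (by rw [hq]; exact admS_all q s hs) hc

end
end CellProof

namespace CellProof
set_option linter.unusedSectionVars false
set_option linter.unusedSimpArgs false

section
variable {V : Type} {G : SimpleGraph V}

lemma deg2_nbrs [Fintype V] {x p q : V} (hd : deg G x = 2) (hp : G.Adj x p) (hq : G.Adj x q)
    (hpq : p ≠ q) : ∀ u, G.Adj x u → u = p ∨ u = q := by
  classical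
  intro u hu
  unfold deg at hd
  have hsub : ({p, q} : Set V) ⊆ G.neighborSet x := by
    rintro z (rfl | rfl)
    · exact hp
    · exact hq
  have he : ({p, q} : Set V) = G.neighborSet x :=
    Set.eq_of_subset_of_ncard_le hsub (by rw [hd, Set.ncard_pair hpq]) (Set.toFinite _)
  have : u ∈ ({p, q} : Set V) := by rw [he]; exact hu
  simpa using this

lemma deg2_other [Fintype V] {x p : V} (hd : deg G x = 2) (hp : G.Adj x p) :
    ∃ q, q ≠ p ∧ G.Adj x q := by
  classical
  unfold deg at hd
  obtain ⟨a, b, hab, he⟩ := Set.ncard_eq_two.1 hd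
  have ha : G.Adj x a := by change a ∈ G.neighborSet x; rw [he]; simp
  have hb : G.Adj x b := by change b ∈ G.neighborSet x; rw [he]; simp
  by_cases h : a = p
  · exact ⟨b, fun e => hab (h.trans e.symm), hb⟩
  · exact ⟨a, h, ha⟩

lemma deg3_of [Fintype V] {x p q r : V} (hp : G.Adj x p) (hq : G.Adj x q) (hr : G.Adj x r)
    (h1 : p ≠ q) (h2 : p ≠ r) (h3 : q ≠ r) : 3 ≤ deg G x := by
  classical
  unfold deg
  have hsub : ({p, q, r} : Set V) ⊆ G.neighborSet x := by
    rintro z (rfl | rfl | rfl)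
    · exact hp
    · exact hq
    · exact hr
  have e : ({p, q, r} : Set V).ncard = 3 := Set.ncard_eq_three.2 ⟨p, q, r, h1, h2, h3, rfl⟩
  rw [← e]
  exact Set.ncard_le_ncard hsub (Set.toFinite _)

lemma deg_ge2 [Fintype V] (h : Critical52 G) {x y : V} (hxy : G.Adj x y) : 2 ≤ deg G x := by
  classical
  by_contra hlt
  have h1 : ∀ u, G.Adj x u → u = y := by
    intro u hu
    by_contra hne
    apply hlt
    unfold deg
    rw [← Set.ncard_pair hne]
    refine Set.ncard_le_ncard ?_ (Set.toFinite _)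
    rintro z (rfl | rfl)
    · exact hu
    · exact hxy
  obtain ⟨f, hf⟩ := sub_col h (Finset.univ.erase x) x (by simp)
  refine crit_ncol h ⟨fun z => if z = x then f y + 1 else f z, ?_⟩
  intro u v huv
  by_cases hu : u = x
  · subst hu
    have hv := h1 v huv
    subst hv
    simp only [if_true, if_neg huv.ne']
    exact Or.inr rfl
  · by_cases hv : v = x
    · subst hv
      have hv := h1 u huv.symm
      subst hv
      simp only [if_true, if_neg hu]
      exact Or.inl rfl
    · simp only [if_neg hu, if_neg hv]
      exact hf u (by simp [hu]) v (by simp [hv]) huv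

lemma walk4 : ∀ s t : Fin 5, ∃ a b c, A5 s a ∧ A5 a b ∧ A5 b c ∧ A5 c t := by decide

lemma no_three [Fintype V] (h : Critical52 G) {p x y z q : V}
    (hx : ∀ u, G.Adj x u → u = p ∨ u = y) (hy : ∀ u, G.Adj y u → u = x ∨ u = z)
    (hz : ∀ u, G.Adj z u → u = y ∨ u = q)
    (hxy : x ≠ y) (hxz : x ≠ z) (hyz : y ≠ z) (hpx : p ≠ x) (hpy : p ≠ y) (hpz : p ≠ z)
    (hqx : q ≠ x) (hqy : q ≠ y) (hqz : q ≠ z) : False := by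
  classical
  obtain ⟨f, hf⟩ := sub_col h (Finset.univ \ {x, y, z}) x (by simp)
  obtain ⟨a, b, c, h1, h2, h3, h4⟩ := walk4 (f p) (f q)
  let g : V → Fin 5 := fun w => if w = x then a else if w = y then b else if w = z then c else f w
  have gx : g x = a := by simp [g]
  have gy : g y = b := by simp [g, hxy.symm]
  have gz : g z = c := by simp [g, hxz.symm, hyz.symm]
  have gp : g p = f p := by simp [g, hpx, hpy, hpz]
  have gq : g q = f q := by simp [g, hqx, hqy, hqz]
  have key : ∀ u v, (u = x ∨ u = y ∨ u = z) → G.Adj u v → A5 (g u) (g v) := by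
    rintro u v (rfl | rfl | rfl) huv
    · rcases hx v huv with rfl | rfl
      · rw [gx, gp]; exact h1.symm
      · rw [gx, gy]; exact h2
    · rcases hy v huv with rfl | rfl
      · rw [gx, gy]; exact h2.symm
      · rw [gy, gz]; exact h3
    · rcases hz v huv with rfl | rfl
      · rw [gy, gz]; exact h3.symm
      · rw [gz, gq]; exact h4
  refine crit_ncol h ⟨g, ?_⟩
  intro u v huv
  by_cases hu : u = x ∨ u = y ∨ u = z
  · exact key u v hu huv
  · by_cases hv : v = x ∨ v = y ∨ v = z
    · exact (key v u hv huv.symm).symm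
    · have e1 : g u = f u := by push Not at hu; simp [g, hu]
      have e2 : g v = f v := by push Not at hv; simp [g, hv]
      rw [e1, e2]
      exact hf u (by simpa using hu) v (by simpa using hv) huv

/-- data of a string with one or two internal vertices leaving `K` -/
structure Str (G : SimpleGraph V) (K : V → Prop) (a : V) (k : ℕ) (y0 y1 b : V)
    (E : Set (Sym2 V)) : Prop where
  cs : (k = 1 ∧ y1 = y0 ∧ ∀ u, G.Adj y0 u → u = a ∨ u = b) ∨
    (k = 2 ∧ y0 ≠ y1 ∧ G.Adj y0 y1 ∧ (∀ u, G.Adj y0 u → u = a ∨ u = y1) ∧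
      (∀ u, G.Adj y1 u → u = y0 ∨ u = b))
  a_y : G.Adj a y0
  y_b : G.Adj y1 b
  ny0 : ¬ K y0
  ny1 : ¬ K y1
  ka : K a
  nb : ¬ K b
  d0 : deg G y0 = 2
  d1 : deg G y1 = 2
  db : 3 ≤ deg G b
  ed : E = {e | e = s(a, y0) ∨ (k = 2 ∧ e = s(y0, y1)) ∨ e = s(y1, b)}

lemma str_of_walk [Fintype V] (K : V → Prop) (hK : ∀ z u, K z → deg G z = 2 → G.Adj z u → K u)
    {a b : V} (p : G.Walk a b) (hp : IsString G p) (ha : K a) (hb : ¬ K b) (k : ℕ)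
    (hk : k = 1 ∨ k = 2) (hl : p.length = k + 1) :
    Str G K a k (p.getVert 1) (p.getVert k) b {e | e ∈ p.edges} := by
  obtain ⟨hpath, -, -, hdb, hinn⟩ := hp
  rcases hk with rfl | rfl
  · cases p with
    | nil => simp at hl
    | @cons _ y _ h1 p =>
      cases p with
      | nil => simp at hl
      | @cons _ y' _ h2 p =>
        cases p with
        | cons h3 p => simp at hl
        | nil =>
          have hd : deg G y = 2 := hinn y (by simp) h1.ne' h2.ne
          have hny : ¬ K y := fun hy => hb (hK y b hy hd h2)
          have hab : a ≠ b := fun e => hb (e ▸ ha)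
          have e1 : (Walk.cons h1 (Walk.cons h2 Walk.nil)).getVert 1 = y := rfl
          rw [e1]
          exact ⟨Or.inl ⟨rfl, rfl, deg2_nbrs hd h1.symm h2 hab⟩, h1, h2, hny, hny, ha, hb, hd, hd,
            hdb, by ext e; simp⟩
  · cases p with
    | nil => simp at hl
    | @cons _ y _ h1 p =>
      cases p with
      | nil => simp at hl
      | @cons _ y' _ h2 p =>
        cases p with
        | nil => simp at hl
        | @cons _ y'' _ h3 p =>
          cases p with
          | cons h4 p => simp at hl
          | nil =>
            simp only [Walk.cons_isPath_iff, Walk.support_cons, Walk.support_nil,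
              List.mem_cons, List.not_mem_nil, or_false, not_or] at hpath
            obtain ⟨⟨⟨-, hn1⟩, hn2, hn3⟩, hn4, hn5, hn6⟩ := hpath
            have hd : deg G y = 2 := hinn y (by simp) h1.ne' hn3
            have hd' : deg G y' = 2 := hinn y' (by simp) (Ne.symm hn5) h3.ne
            have hny' : ¬ K y' := fun hy => hb (hK y' b hy hd' h3)
            have hny : ¬ K y := fun hy => hny' (hK y y' hy hd h2)
            have e2 : (Walk.cons h1 (Walk.cons h2 (Walk.cons h3 Walk.nil))).getVert 2 = y' := rfl
            have e1 : (Walk.cons h1 (Walk.cons h2 (Walk.cons h3 Walk.nil))).getVert 1 = y := rfl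
            rw [e1, e2]
            exact ⟨Or.inr ⟨rfl, h2.ne, h2, deg2_nbrs hd h1.symm h2 hn5,
              deg2_nbrs hd' h2.symm h3 hn3⟩, h1, h3, hny, hny', ha, hb, hd, hd',
              hdb, by ext e; simp⟩

lemma Str.disj {K : V → Prop} {a k y0 y1 b E a' k' y0' y1' b' E'} (S : Str G K a k y0 y1 b E)
    (S' : Str G K a' k' y0' y1' b' E')
    (hm : y0 = y0' ∨ y0 = y1' ∨ y1 = y0' ∨ y1 = y1') : E = E' := by
  obtain ⟨c, h1, h2, h3, h4, h5, h6, h7, h8, h9, rfl⟩ := S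
  obtain ⟨c', h1', h2', h3', h4', h5', h6', h7', h8', h9', rfl⟩ := S'
  have s1 := h1.symm
  have s1' := h1'.symm
  rcases c with ⟨rfl, rfl, c⟩ | ⟨rfl, n, ad, c, d⟩ <;>
  rcases c' with ⟨rfl, rfl, c'⟩ | ⟨rfl, n', ad', c', d'⟩
  · have e : y1 = y1' := by tauto
    subst e
    have e1 : a = a' := by
      rcases c' a s1 with h | h
      · exact h
      · exact absurd h5 (h ▸ h6')
    have e2 : b = b' := by
      rcases c' b h2 with h | h
      · exact absurd h5' (h ▸ h6)
      · exact h
    rw [e1, e2]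
  · exfalso
    have hm : y1 = y0' ∨ y1 = y1' := by tauto
    rcases hm with rfl | rfl
    · have e : b = y1' := by
        rcases c' b h2 with h | h
        · exact absurd h5' (h ▸ h6)
        · exact h
      rw [e] at h9; omega
    · rcases d' a s1 with rfl | rfl
      · exact h3' h5
      · exact h6' h5
  · exfalso
    have hm : y1' = y0 ∨ y1' = y1 := by tauto
    rcases hm with rfl | rfl
    · have e : b' = y1 := by
        rcases c b' h2' with h | h
        · exact absurd h5 (h ▸ h6')
        · exact h
      rw [e] at h9'; omega
    · rcases d a' s1' with rfl | rfl
      · exact h3 h5'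
      · exact h6 h5'
  · have key : y0 = y0' ∧ y1 = y1' := by
      rcases hm with rfl | rfl | rfl | rfl
      · refine ⟨rfl, ?_⟩
        rcases c' y1 ad with rfl | h
        · exact absurd h5' h4
        · exact h
      · rcases d' a s1 with rfl | rfl
        · exact absurd h5 h3'
        · exact absurd h5 h6'
      · rcases d a' s1' with rfl | rfl
        · exact absurd h5' h3
        · exact absurd h5' h6
      · refine ⟨?_, rfl⟩
        rcases d' y0 ad.symm with h | rfl
        · exact h
        · omega
    obtain ⟨rfl, rfl⟩ := key
    have e1 : a = a' := by
      rcases c' a s1 with h | rfl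
      · exact h
      · exact absurd h5 h4
    have e2 : b = b' := by
      rcases d' b h2 with rfl | h
      · omega
      · exact h
    rw [e1, e2]
end
end CellProof

namespace CellProof
set_option linter.unusedSectionVars false
set_option linter.unusedSimpArgs false

section
variable {V : Type} [Fintype V] {G : SimpleGraph V}

lemma PP_cycle [DecidableEq V] (v : Fin 5 → V) (vinj : Function.Injective v)
    (vadj : ∀ i, G.Adj (v i) (v (i + 1))) : PP G (Finset.univ.image v) ≤ 5 := by
  have hne : ∀ i j, i ≠ j → v i ≠ v j := fun i j hij e => hij (vinj e)
  have a01 := vadj 0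
  have a12 := vadj 1
  have a23 := vadj 2
  have a34 := vadj 3
  have a40 := vadj 4
  simp only [Fin.reduceAdd] at a01 a12 a23 a34 a40
  have e1 := PP_insert G {v 0} {v 0} (v 1) (by simp [hne]) (by simp) (by simp [a01.symm])
  have e2 := PP_insert G {v 1, v 0} {v 1} (v 2) (by simp [hne]) (by simp) (by simp [a12.symm])
  have e3 := PP_insert G {v 2, v 1, v 0} {v 2} (v 3) (by simp [hne]) (by simp)
    (by simp [a23.symm])
  have e4 := PP_insert G {v 3, v 2, v 1, v 0} {v 3, v 0} (v 4) (by simp [hne])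
    (by intro x; simp; tauto) (by simp [a34.symm, a40])
  have e5 : (Finset.univ.image v) = {v 4, v 3, v 2, v 1, v 0} := by
    ext x
    simp only [Finset.mem_image, Finset.mem_univ, true_and, Fin.exists_fin_succ,
      Finset.mem_insert, Finset.mem_singleton, Fin.exists_fin_zero]
    simp [eq_comm]
    tauto
  rw [e5]
  rw [PP_singleton] at e1
  rw [Finset.card_pair (hne 3 0 (by decide))] at e4
  rw [Finset.card_singleton] at e1 e2 e3
  push_cast at *
  linarith

lemma explore (h : SmallestCex G) (v : Fin 5 → V) (vinj : Function.Injective v)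
    (vadj : ∀ i, G.Adj (v i) (v (i + 1))) (b0 : V) (hb0 : ∀ t, b0 ≠ v t) (hd0 : 3 ≤ deg G b0)
    (t : Fin 5) (u : V) (hu : G.Adj (v t) u) (hnu : ∀ t', A5 t t' → u ≠ v t') :
    ∃ (b : V) (q : G.Walk (v t) b), IsString G q ∧ (∀ t', b ≠ v t') ∧ s(v t, u) ∈ q.edges := by
  classical
  have hcK := PP_cycle v vinj vadj
  set K := Finset.univ.image v with hKdef
  have memK : ∀ x, x ∈ K ↔ ∃ t, x = v t := by intro x; simp [hKdef, eq_comm]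
  have hbK : b0 ∉ K := by rw [memK]; push Not; exact hb0
  have hcard : 4 ≤ Fintype.card V := by
    have := Fintype.card_le_of_injective _ vinj
    simp at this; omega
  have hΔ := no_triangle h hcard
  have htK : v t ∈ K := (memK _).2 ⟨t, rfl⟩
  have vadj' : ∀ i, G.Adj (v (i + 1)) (v i) := fun i => (vadj i).symm
  have ap : G.Adj (v t) (v (t + 1)) := vadj t
  have am : G.Adj (v t) (v (t + 4)) := by
    have := vadj' (t + 4)
    rwa [add_assoc, show (4 : Fin 5) + 1 = 0 from rfl, add_zero] at this
  have uK : u ∉ K := by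
    rw [memK]
    rintro ⟨t', rfl⟩
    have hc : ∀ t t' : Fin 5, ¬ A5 t t' → t ≠ t' → t' = t + 1 + 1 ∨ t = t' + 1 + 1 := by decide
    have hna : ¬ A5 t t' := fun ha => hnu t' ha rfl
    have hne : t ≠ t' := by rintro rfl; exact hu.ne rfl
    rcases hc t t' hna hne with rfl | rfl
    · exact hΔ _ _ _ (vadj t) (vadj (t + 1)) hu.symm
    · exact hΔ _ _ _ (vadj t') (vadj (t' + 1)) hu
  have hdt : 3 ≤ deg G (v t) := by
    refine deg3_of ap am hu ?_ ?_ ?_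
    · intro e; exact (by decide : ∀ t : Fin 5, t + 1 ≠ t + 4) t (vinj e)
    · exact (hnu _ (Or.inl rfl)).symm
    · refine (hnu _ (Or.inr ?_)).symm
      rw [add_assoc, show (4 : Fin 5) + 1 = 0 from rfl, add_zero]
  have hout : ∀ x, x ∉ K → ∀ t', x ≠ v t' := by
    intro x hx t' e; exact hx ((memK x).2 ⟨t', e⟩)
  have hge : ∀ x y, G.Adj x y → deg G x = 2 ∨ 3 ≤ deg G x := by
    intro x y hxy; have := deg_ge2 h.1 hxy; omega
  have kne : ∀ {x y}, x ∈ K → y ∉ K → x ≠ y := by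
    rintro x y hx hy rfl; exact hy hx
  have edge1 := PP_insert G K {v t} u uK (by simpa using htK) (by simpa using hu.symm)
  rcases hge u (v t) hu.symm with du | du
  swap
  · refine ⟨u, Walk.cons hu Walk.nil, ⟨?_, ?_, hdt, du, ?_⟩, hout u uK, ?_⟩
    · simp [hu.ne]
    · simp
    · intro w hw h1 h2; simp [h1, h2] at hw
    · simp
  obtain ⟨u2, hu2t, hu2⟩ := deg2_other du hu.symm
  have nu := deg2_nbrs du hu.symm hu2 hu2t.symm
  by_cases u2K : u2 ∈ K
  · have := PP_insert G K {v t, u2} u uK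
      (by intro x; simp only [Finset.mem_insert, Finset.mem_singleton]
          rintro (rfl | rfl) <;> assumption)
      (by simp [hu.symm, hu2])
    rw [Finset.card_pair hu2t.symm] at this
    have h4 := P4 h (insert u K) (by simp) b0 (by
      simp only [Finset.mem_insert, not_or]
      exact ⟨by rintro rfl; omega, hbK⟩)
    push_cast at this
    omega
  rcases hge u2 u hu2.symm with du2 | du2
  swap
  · refine ⟨u2, Walk.cons hu (Walk.cons hu2 Walk.nil), ⟨?_, ?_, hdt, du2, ?_⟩, hout u2 u2K, ?_⟩
    · simp [hu.ne, hu2.ne, hu2t.symm]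
    · simp
    · intro w hw h1 h2; simp [h1, h2] at hw; rw [hw]; exact du
    · simp
  obtain ⟨u3, hu3u, hu3⟩ := deg2_other du2 hu2.symm
  have nu2 := deg2_nbrs du2 hu2.symm hu3 hu3u.symm
  by_cases u3K : u3 ∈ K
  · have := PP_insert G (insert u K) {u, u3} u2
      (by simp only [Finset.mem_insert, not_or]; exact ⟨hu2.ne', u2K⟩)
      (by intro x; simp only [Finset.mem_insert, Finset.mem_singleton]
          rintro (rfl | rfl)
          · exact Or.inl rfl
          · exact Or.inr u3K)
      (by simp [hu2.symm, hu3])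
    rw [Finset.card_pair hu3u.symm] at this
    rw [Finset.card_singleton] at edge1
    have h4 := P4 h (insert u2 (insert u K)) (by simp) b0 (by
      simp only [Finset.mem_insert, not_or]
      exact ⟨by rintro rfl; omega, by rintro rfl; omega, hbK⟩)
    push_cast at this edge1
    omega
  rcases hge u3 u2 hu3.symm with du3 | du3
  swap
  · refine ⟨u3, Walk.cons hu (Walk.cons hu2 (Walk.cons hu3 Walk.nil)),
      ⟨?_, ?_, hdt, du3, ?_⟩, hout u3 u3K, ?_⟩
    · simp [hu.ne, hu2.ne, hu2t.symm, hu3.ne, hu3u.symm, kne htK u3K]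
    · simp
    · intro w hw h1 h2; simp [h1, h2] at hw
      rcases hw with rfl | rfl
      · exact du
      · exact du2
    · simp
  exfalso
  obtain ⟨w, hwu2, hw⟩ := deg2_other du3 hu3.symm
  have nu3 := deg2_nbrs du3 hu3.symm hw hwu2.symm
  refine no_three h.1 nu nu2 nu3 hu2.ne hu3u.symm hu3.ne hu.ne hu2t.symm (kne htK u3K)
    ?_ hwu2 hw.ne'
  rintro rfl
  rcases nu u3 hw.symm with rfl | rfl
  · exact u3K htK
  · exact hu3.ne rfl

end
end CellProof

namespace CellProof
set_option linter.unusedSectionVars false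
set_option linter.unusedSimpArgs false

section
variable {V : Type} [Fintype V] {G : SimpleGraph V}

theorem strings_false (h : SmallestCex G) (v : Fin 5 → V) (vinj : Function.Injective v)
    (vadj : ∀ i, G.Adj (v i) (v (i + 1))) (K : V → Prop) (hKv : ∀ x, K x ↔ ∃ t, x = v t)
    (a y0 y1 b : Fin 4 → V) (q : Fin 4) (E : Fin 4 → Set (Sym2 V)) (Einj : Function.Injective E)
    (S : ∀ i, Str G K (a i) (KS q i) (y0 i) (y1 i) (b i) (E i)) (ha0 : a 0 = v 0)
    (hall : ∀ (x z : V) (p : G.Walk x z), IsString G p → K x → ¬ K z →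
      ∃ i, {e | e ∈ p.edges} = E i) : False := by
  have hj : ∀ i, ∃ t, a i = v t := fun i => (hKv _).1 (S i).ka
  choose j hj using hj
  have nK : ∀ {x}, ¬ K x → ∀ t, x ≠ v t := fun hx t e => hx ((hKv _).2 ⟨t, e⟩)
  let C : Cell G :=
    { v := v, k := KS q, j := j, y := fun i => ![y0 i, y1 i], b := b, vinj := vinj, vadj := vadj
      hk := by
        intro i
        rcases (S i).cs with c | c
        · exact Or.inl c.1
        · exact Or.inr c.1
      y1 := by
        intro i hi
        rcases (S i).cs with c | c
        · exact c.2.1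
        · omega
      y2 := by
        intro i hi
        rcases (S i).cs with c | c
        · omega
        · exact ⟨c.2.1, c.2.2.1⟩
      yv := by
        intro i l t
        fin_cases l
        · exact nK (S i).ny0 t
        · exact nK (S i).ny1 t
      yy := by
        intro i l i' l' e
        apply Einj
        apply (S i).disj (S i')
        fin_cases l <;> fin_cases l'
        · exact Or.inl e
        · exact Or.inr (Or.inl e)
        · exact Or.inr (Or.inr (Or.inl e))
        · exact Or.inr (Or.inr (Or.inr e))
      bv := fun i t => nK (S i).nb t
      bny := by
        intro i i' l e
        have d := (S i).db
        rw [e] at d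
        have d0 := (S i').d0
        have d1 := (S i').d1
        fin_cases l
        · change 3 ≤ deg G (y0 i') at d; omega
        · change 3 ≤ deg G (y1 i') at d; omega
      a_y := by intro i; rw [← hj i]; exact (S i).a_y
      y_b := fun i => (S i).y_b
      vE := by
        intro t u hu
        by_cases hn : ∃ t', u = v t' ∧ A5 t t'
        · exact Or.inl hn
        · right
          obtain ⟨z, p, hp, hz, hmem⟩ := explore h v vinj vadj (b 0) (nK (S 0).nb) (S 0).db t u hu
            (fun t' ht e => hn ⟨t', e, ht⟩)
          obtain ⟨i, hi⟩ := hall _ _ p hp ((hKv _).2 ⟨t, rfl⟩)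
            (by rw [hKv]; push Not; exact hz)
          have hm : s(v t, u) ∈ E i := by rw [← hi]; exact hmem
          rw [(S i).ed] at hm
          have hvt : K (v t) := (hKv _).2 ⟨t, rfl⟩
          have n0 := (S i).ny0
          have n1 := (S i).ny1
          have nb := (S i).nb
          refine ⟨i, ?_⟩
          rcases hm with hm | ⟨_, hm⟩ | hm
          · rcases Sym2.eq_iff.1 hm with ⟨e1, e2⟩ | ⟨e1, e2⟩
            · exact ⟨vinj (e1.trans (hj i)), e2⟩
            · exact absurd hvt (e1 ▸ n0)
          · rcases Sym2.eq_iff.1 hm with ⟨e1, e2⟩ | ⟨e1, e2⟩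
            · exact absurd hvt (e1 ▸ n0)
            · exact absurd hvt (e1 ▸ n1)
          · rcases Sym2.eq_iff.1 hm with ⟨e1, e2⟩ | ⟨e1, e2⟩
            · exact absurd hvt (e1 ▸ n1)
            · exact absurd hvt (e1 ▸ nb)
      yE0 := by
        intro i u hu
        rw [← hj i]
        rcases (S i).cs with c | c
        · rcases c.2.2 u hu with e | e
          · exact Or.inl e
          · exact Or.inr (Or.inr ⟨c.1, e⟩)
        · rcases c.2.2.2.1 u hu with e | e
          · exact Or.inl e
          · exact Or.inr (Or.inl ⟨c.1, e⟩)
      yE1 := by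
        intro i u hi hu
        rcases (S i).cs with c | c
        · omega
        · exact c.2.2.2.2 u hu }
  exact cell_false h C q rfl (vinj ((hj 0).symm.trans ha0))

lemma cycle_fun {w : V} (c : G.Walk w w) (hc : c.IsCycle) (hc5 : c.length = 5) (a : V)
    (ha : a ∈ c.support) : ∃ v : Fin 5 → V, Function.Injective v ∧
      (∀ i, G.Adj (v i) (v (i + 1))) ∧ (∀ x, x ∈ c.support ↔ ∃ t, x = v t) ∧ v 0 = a := by
  classical
  let d := c.rotate a ha
  have hd : d.IsCycle := hc.rotate ha
  have hd5 : d.length = 5 := by rw [← hc5]; exact Walk.length_rotate c a ha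
  have hadj : ∀ i < 5, G.Adj (d.getVert i) (d.getVert (i + 1)) := by
    intro i hi; exact d.adj_getVert_succ (by omega)
  have h5 : d.getVert 5 = d.getVert 0 := by rw [Walk.getVert_zero, ← hd5, Walk.getVert_length]
  refine ⟨fun t => d.getVert t.val, ?_, ?_, ?_, ?_⟩
  · intro s t hst
    have := hd.getVert_injOn' (by simp; omega : s.val ∈ _) (by simp; omega : t.val ∈ _) hst
    exact Fin.ext this
  · intro i
    have := hadj i.val i.isLt
    fin_cases i <;> first | exact this | (simp at this ⊢; rw [h5] at this; simpa using this)
  · intro x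
    have : x ∈ c.support ↔ x ∈ d.support := (Walk.mem_support_rotate_iff c a ha).symm
    rw [this, Walk.mem_support_iff_exists_getVert]
    constructor
    · rintro ⟨n, hn, hle⟩
      rw [hd5] at hle
      by_cases h : n = 5
      · subst h; exact ⟨0, by rw [← hn, h5]; rfl⟩
      · exact ⟨⟨n, by omega⟩, hn.symm⟩
    · rintro ⟨t, rfl⟩; exact ⟨t.val, rfl, by omega⟩
  · simp

end
end CellProof

open CellProof

/-- If `K` is a `(2,k₂,k₃,k₄)`-cell in a smallest counterexample, where
`2 ≥ k₂ ≥ k₃ ≥ k₄ ≥ 0`, then `k₄ = 0`. Here `K` being a `(2,k₂,k₃,k₄)`-cell is expressed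
by: `K` is a 5-cycle, `p1, p2, p3, p4` are strings with exactly one end in `K` and with
the prescribed lengths, they are pairwise distinct (as edge sets), and every string with
exactly one end in `K` coincides (as an edge set) with one of them. -/
theorem smallestCex_cell_2kkk {V : Type} [Fintype V] (G : SimpleGraph V)
    (h : SmallestCex G) (k2 k3 k4 : ℕ)
    (hk2 : k2 ≤ 2) (hk32 : k3 ≤ k2) (hk43 : k4 ≤ k3)
    (w : V) (c : G.Walk w w) (hc : c.IsCycle) (hc5 : c.length = 5)
    (a1 b1 a2 b2 a3 b3 a4 b4 : V)
    (p1 : G.Walk a1 b1) (p2 : G.Walk a2 b2) (p3 : G.Walk a3 b3) (p4 : G.Walk a4 b4)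
    (hs1 : IsString G p1) (hs2 : IsString G p2) (hs3 : IsString G p3) (hs4 : IsString G p4)
    (he1 : a1 ∈ c.support ∧ b1 ∉ c.support) (he2 : a2 ∈ c.support ∧ b2 ∉ c.support)
    (he3 : a3 ∈ c.support ∧ b3 ∉ c.support) (he4 : a4 ∈ c.support ∧ b4 ∉ c.support)
    (hl1 : p1.length = 2 + 1) (hl2 : p2.length = k2 + 1)
    (hl3 : p3.length = k3 + 1) (hl4 : p4.length = k4 + 1)
    (hd12 : {e | e ∈ p1.edges} ≠ {e | e ∈ p2.edges})
    (hd13 : {e | e ∈ p1.edges} ≠ {e | e ∈ p3.edges})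
    (hd14 : {e | e ∈ p1.edges} ≠ {e | e ∈ p4.edges})
    (hd23 : {e | e ∈ p2.edges} ≠ {e | e ∈ p3.edges})
    (hd24 : {e | e ∈ p2.edges} ≠ {e | e ∈ p4.edges})
    (hd34 : {e | e ∈ p3.edges} ≠ {e | e ∈ p4.edges})
    (hall : ∀ (a b : V) (q : G.Walk a b), IsString G q → a ∈ c.support → b ∉ c.support →
      {e | e ∈ q.edges} = {e | e ∈ p1.edges} ∨ {e | e ∈ q.edges} = {e | e ∈ p2.edges} ∨
      {e | e ∈ q.edges} = {e | e ∈ p3.edges} ∨ {e | e ∈ q.edges} = {e | e ∈ p4.edges}) :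
    k4 = 0 := by
  classical
  by_contra hk4
  obtain ⟨v, vinj, vadj, hKv, hv0⟩ := cycle_fun c hc hc5 a1 he1.1
  have hK : ∀ z u, z ∈ c.support → deg G z = 2 → G.Adj z u → u ∈ c.support := by
    intro z u hz hd hzu
    obtain ⟨t, rfl⟩ := (hKv z).1 hz
    have am : G.Adj (v t) (v (t + 4)) := by
      have := (vadj (t + 4)).symm
      rwa [add_assoc, show (4 : Fin 5) + 1 = 0 from rfl, add_zero] at this
    have hne : v (t + 1) ≠ v (t + 4) := by
      intro e; exact (by decide : ∀ t : Fin 5, t + 1 ≠ t + 4) t (vinj e)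
    rcases deg2_nbrs hd (vadj t) am hne u hzu with e | e
    · exact (hKv u).2 ⟨_, e⟩
    · exact (hKv u).2 ⟨_, e⟩
  obtain ⟨q, hq⟩ : ∃ q : Fin 4, KS q = ![2, k2, k3, k4] := by
    have : (k2 = 1 ∨ k2 = 2) ∧ (k3 = 1 ∨ k3 = 2) ∧ (k4 = 1 ∨ k4 = 2) := by omega
    obtain ⟨rfl | rfl, rfl | rfl, rfl | rfl⟩ := this
    · exact ⟨3, rfl⟩
    · omega
    · omega
    · omega
    · exact ⟨2, rfl⟩
    · omega
    · exact ⟨1, rfl⟩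
    · exact ⟨0, rfl⟩
  refine strings_false h v vinj vadj (· ∈ c.support) hKv ![a1, a2, a3, a4]
    ![p1.getVert 1, p2.getVert 1, p3.getVert 1, p4.getVert 1]
    ![p1.getVert 2, p2.getVert k2, p3.getVert k3, p4.getVert k4] ![b1, b2, b3, b4] q
    ![{e | e ∈ p1.edges}, {e | e ∈ p2.edges}, {e | e ∈ p3.edges}, {e | e ∈ p4.edges}] ?_ ?_
    hv0.symm ?_
  · have s12 := hd12.symm
    have s13 := hd13.symm
    have s14 := hd14.symm
    have s23 := hd23.symm
    have s24 := hd24.symm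
    have s34 := hd34.symm
    intro i j hij
    fin_cases i <;> fin_cases j <;> first | rfl | exact absurd hij (by assumption)
  · rw [hq]
    intro i
    fin_cases i
    · exact str_of_walk _ hK p1 hs1 he1.1 he1.2 2 (by omega) hl1
    · exact str_of_walk _ hK p2 hs2 he2.1 he2.2 k2 (by omega) hl2
    · exact str_of_walk _ hK p3 hs3 he3.1 he3.2 k3 (by omega) hl3
    · exact str_of_walk _ hK p4 hs4 he4.1 he4.2 k4 (by omega) hl4
  · intro x z p hp hx hz
    rcases hall x z p hp hx hz with e | e | e | e
    · exact ⟨0, e⟩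
    · exact ⟨1, e⟩
    · exact ⟨2, e⟩
    · exact ⟨3, e⟩
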